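/- (Existence of a ground state for the stationary vibrating plate equation) Let d ≥ 3. There exists a function v in the Schwartz class 𝒮(ℝ^d), real-valued with v(x) > 0 for all x ∈ ℝ^d, such that, setting W(x) := -5v(x)⁸ + 24v(x)⁶ - 33v(x)⁴ + 12v(x)² - 20v(x)²|∇v(x)|² + 18|∇v(x)|², the function W also belongs to the Schwartz class 𝒮(ℝ^d) and the fourth-order equation Δ(Δv)(x) - v(x) + W(x)·v(x) = 0 holds for all x ∈ ℝ^d. -/

import Mathlib

open MeasureTheory Filter
open scoped ENNReal

noncomputable section

/-- `d`-dimensional Euclidean space. -/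
abbrev Ed (d : ℕ) := EuclideanSpace ℝ (Fin d)

/-- The Laplacian `Δf(x) = Σ_{i=1}^d ∂²f/∂x_i²(x)` of a real-valued function. -/
def lap (d : ℕ) (f : Ed d → ℝ) (x : Ed d) : ℝ :=
  ∑ i : Fin d, fderiv ℝ (fun y => fderiv ℝ f y (EuclideanSpace.single i 1)) x
    (EuclideanSpace.single i 1)

/-- Squared norm of the gradient: `|∇f(x)|² = Σ_{i=1}^d (∂f/∂x_i)(x)²`. -/
def gradSq (d : ℕ) (f : Ed d → ℝ) (x : Ed d) : ℝ :=
  ∑ i : Fin d, (fderiv ℝ f x (EuclideanSpace.single i 1)) ^ 2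

/-- The weighted average `∫₀¹ ρᵏ h(sρ²) dρ`. -/
def radialAvg (k : ℕ) (h : ℝ → ℝ) (s : ℝ) : ℝ :=
  ∫ ρ in (0 : ℝ)..1, ρ ^ k * h (s * ρ ^ 2)

lemma continuous_radialAvg (k : ℕ) {h : ℝ → ℝ} (hh : Continuous h) :
    Continuous (radialAvg k h) := by
  refine intervalIntegral.continuous_parametric_intervalIntegral_of_continuous'
    (f := fun s ρ => ρ ^ k * h (s * ρ ^ 2)) ?_ 0 1
  simp only [Function.uncurry_def]
  fun_prop

lemma abs_le_of_mem_uIoc_zero_one {ρ : ℝ} (hρ : ρ ∈ Set.uIoc (0 : ℝ) 1) : 0 < ρ ∧ ρ ≤ 1 := by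
  rw [Set.uIoc_of_le zero_le_one] at hρ
  exact hρ

lemma hasDerivAt_radialAvg (k : ℕ) {h : ℝ → ℝ} (hh : ContDiff ℝ 1 h) (s : ℝ) :
    HasDerivAt (radialAvg k h) (radialAvg (k + 2) (deriv h) s) s := by
  have hc : Continuous (deriv h) := hh.continuous_deriv le_rfl
  have h0 : Continuous h := hh.continuous
  obtain ⟨C, hC⟩ := (isCompact_Icc (a := -(|s| + 1)) (b := |s| + 1)).exists_bound_of_continuousOn
    hc.continuousOn
  have key := intervalIntegral.hasDerivAt_integral_of_dominated_loc_of_deriv_le (μ := volume)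
    (a := 0) (b := 1) (bound := fun _ => C) (F := fun s ρ => ρ ^ k * h (s * ρ ^ 2))
    (F' := fun s ρ => ρ ^ (k + 2) * deriv h (s * ρ ^ 2)) (x₀ := s) (s := Metric.ball s 1)
    (Metric.ball_mem_nhds s one_pos)
    (Eventually.of_forall fun x => Continuous.aestronglyMeasurable (by fun_prop))
    (Continuous.intervalIntegrable (by fun_prop) _ _)
    (Continuous.aestronglyMeasurable (by fun_prop))
    (ae_of_all _ fun ρ hρ x hx => ?_)
    (Continuous.intervalIntegrable (by fun_prop) _ _)
    (ae_of_all _ fun ρ hρ x hx => ?_)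
  · exact key.2
  · obtain ⟨h1, h2⟩ := abs_le_of_mem_uIoc_zero_one hρ
    have hx' : |x| ≤ |s| + 1 := by
      rw [Metric.mem_ball, Real.dist_eq] at hx
      have := abs_add_le (x - s) s
      rw [sub_add_cancel] at this
      linarith
    have h3 : |x * ρ ^ 2| ≤ |s| + 1 := by
      rw [abs_mul, abs_of_nonneg (sq_nonneg ρ)]
      have : ρ ^ 2 ≤ 1 := pow_le_one₀ h1.le h2
      nlinarith [abs_nonneg x]
    rw [norm_mul, Real.norm_of_nonneg (by positivity)]
    have h4 := hC _ (abs_le.mp h3)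
    have h5 : ρ ^ (k + 2) ≤ 1 := pow_le_one₀ h1.le h2
    nlinarith [norm_nonneg (deriv h (x * ρ ^ 2))]
  · have h1 : HasDerivAt (fun x : ℝ => x * ρ ^ 2) (1 * ρ ^ 2) x :=
      (hasDerivAt_id x).mul_const _
    have h2 : HasDerivAt h (deriv h (x * ρ ^ 2)) (x * ρ ^ 2) :=
      (hh.differentiable one_ne_zero _).hasDerivAt
    refine ((h2.comp x h1).const_mul (ρ ^ k)).congr_deriv ?_
    ring

lemma contDiff_radialAvg (n : ℕ) (k : ℕ) {h : ℝ → ℝ} (hh : ContDiff ℝ n h) :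
    ContDiff ℝ n (radialAvg k h) := by
  induction n generalizing k h with
  | zero =>
    rw [Nat.cast_zero, contDiff_zero] at *
    exact continuous_radialAvg k hh
  | succ n ih =>
    have h1 : ContDiff ℝ 1 h := hh.of_le (by push_cast; exact le_add_self)
    rw [Nat.cast_succ, contDiff_succ_iff_deriv] at *
    refine ⟨fun s => (hasDerivAt_radialAvg k h1 s).differentiableAt, by simp, ?_⟩
    rw [funext fun s => (hasDerivAt_radialAvg k h1 s).deriv]
    exact ih _ hh.2.2

lemma radialAvg_integration_by_parts (k : ℕ) {h : ℝ → ℝ} (hh : ContDiff ℝ 1 h) (s : ℝ) :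
    (k + 1) * radialAvg k h s + 2 * s * radialAvg (k + 2) (deriv h) s = h s := by
  have hc : Continuous (deriv h) := hh.continuous_deriv le_rfl
  have h0 : Continuous h := hh.continuous
  have key := intervalIntegral.integral_eq_sub_of_hasDerivAt (a := 0) (b := 1)
    (f := fun ρ : ℝ => ρ ^ (k + 1) * h (s * ρ ^ 2))
    (f' := fun ρ => (k + 1) * (ρ ^ k * h (s * ρ ^ 2))
      + 2 * s * (ρ ^ (k + 2) * deriv h (s * ρ ^ 2)))
    (fun ρ _ => ?_) (Continuous.intervalIntegrable (by fun_prop) _ _)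
  · rw [intervalIntegral.integral_add (Continuous.intervalIntegrable (by fun_prop) _ _)
      (Continuous.intervalIntegrable (by fun_prop) _ _), intervalIntegral.integral_const_mul,
      intervalIntegral.integral_const_mul] at key
    simpa [radialAvg] using key
  · have h1 : HasDerivAt (fun x : ℝ => s * x ^ 2) (s * (2 * ρ)) ρ := by
      simpa using ((hasDerivAt_id ρ).pow 2).const_mul s
    have h2 : HasDerivAt h (deriv h (s * ρ ^ 2)) (s * ρ ^ 2) :=
      (hh.differentiable one_ne_zero _).hasDerivAt
    refine ((hasDerivAt_pow (k + 1) ρ).mul (h2.comp ρ h1)).congr_deriv ?_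
    simp only [Nat.cast_add, Nat.cast_one, Nat.add_sub_cancel, Function.comp]
    ring

/-- Comparison of two weighted averages when the integrands differ by at most `B`. -/
lemma abs_radialAvg_sub_le (k : ℕ) {h₁ h₂ : ℝ → ℝ} (c₁ : Continuous h₁) (c₂ : Continuous h₂)
    {s B : ℝ} (hB : ∀ ρ ∈ Set.Icc (0 : ℝ) 1, |h₁ (s * ρ ^ 2) - h₂ (s * ρ ^ 2)| ≤ B) :
    |radialAvg k h₁ s - radialAvg k h₂ s| ≤ B := by
  rw [radialAvg, radialAvg, ← intervalIntegral.integral_sub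
    (Continuous.intervalIntegrable (by fun_prop) _ _)
    (Continuous.intervalIntegrable (by fun_prop) _ _), ← Real.norm_eq_abs]
  have := intervalIntegral.norm_integral_le_of_norm_le_const (a := 0) (b := 1) (C := B)
    (f := fun ρ : ℝ => ρ ^ k * h₁ (s * ρ ^ 2) - ρ ^ k * h₂ (s * ρ ^ 2)) (fun ρ hρ => ?_)
  · simpa using this
  · obtain ⟨h1, h2⟩ := abs_le_of_mem_uIoc_zero_one hρ
    rw [← mul_sub, norm_mul, Real.norm_of_nonneg (by positivity), Real.norm_eq_abs]
    have h5 : ρ ^ k ≤ 1 := pow_le_one₀ h1.le h2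
    have := hB ρ ⟨h1.le, h2⟩
    nlinarith [abs_nonneg (h₁ (s * ρ ^ 2) - h₂ (s * ρ ^ 2))]

lemma radialAvg_le (k : ℕ) {h : ℝ → ℝ} (hc : Continuous h) {s B : ℝ}
    (hB : ∀ ρ ∈ Set.Icc (0 : ℝ) 1, h (s * ρ ^ 2) ≤ B) :
    radialAvg k h s ≤ B / (k + 1) := by
  have h1 : ∫ ρ in (0 : ℝ)..1, ρ ^ k * B = B / (k + 1) := by
    rw [intervalIntegral.integral_mul_const, integral_pow]
    simp
    ring
  rw [← h1]
  refine intervalIntegral.integral_mono_on zero_le_one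
    (Continuous.intervalIntegrable (by fun_prop) _ _)
    (Continuous.intervalIntegrable (by fun_prop) _ _) fun ρ hρ => ?_
  exact mul_le_mul_of_nonneg_left (hB ρ hρ) (pow_nonneg hρ.1 _)

lemma abs_integral_le_mul_cosh {f : ℝ → ℝ} {c K : ℝ} (hK : 0 < K) (hc : 0 ≤ c)
    (hf : ∀ σ, |f σ| ≤ c * Real.cosh (K * σ)) (s : ℝ) :
    |∫ σ in (0 : ℝ)..s, f σ| ≤ c / K * Real.cosh (K * s) := by
  have h1 : ∫ σ in (0 : ℝ)..s, c * Real.cosh (K * σ) = c / K * Real.sinh (K * s) := by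
    rw [intervalIntegral.integral_eq_sub_of_hasDerivAt
      (f := fun σ => c / K * Real.sinh (K * σ)) (fun σ _ => ?_)
      (Continuous.intervalIntegrable (by fun_prop) _ _)]
    · simp
    · have h2 : HasDerivAt (fun σ : ℝ => K * σ) K σ := by
        simpa using (hasDerivAt_id σ).const_mul K
      refine (h2.sinh.const_mul (c / K)).congr_deriv ?_
      field_simp
  have h2 := intervalIntegral.norm_integral_le_abs_of_norm_le (μ := volume) (a := 0) (b := s)
    (f := f) (g := fun σ => c * Real.cosh (K * σ)) (ae_of_all _ hf)
    (Continuous.intervalIntegrable (by fun_prop) _ _)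
  rw [h1, abs_mul, abs_of_nonneg (by positivity : 0 ≤ c / K), Real.abs_sinh] at h2
  refine h2.trans (mul_le_mul_of_nonneg_left ?_ (by positivity))
  rw [← Real.cosh_abs (K * s)]
  exact (Real.sinh_lt_cosh _).le

lemma cosh_mul_mul_sq_le (K s : ℝ) {ρ : ℝ} (hρ : ρ ∈ Set.Icc (0 : ℝ) 1) :
    Real.cosh (K * (s * ρ ^ 2)) ≤ Real.cosh (K * s) := by
  rw [Real.cosh_le_cosh, ← mul_assoc, abs_mul _ (ρ ^ 2), abs_of_nonneg (sq_nonneg ρ)]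
  exact mul_le_of_le_one_right (abs_nonneg _) (pow_le_one₀ hρ.1 hρ.2)

/-- The right-hand side of the integral equation of the radial initial value problem. -/
def radialRHS (k : ℕ) (g : ℝ → ℝ) (α : ℝ) (w : ℝ → ℝ) (s : ℝ) : ℝ :=
  α + ∫ σ in (0 : ℝ)..s, 1 / 2 * radialAvg k (g ∘ w) σ

lemma continuous_radialRHS (k : ℕ) {g w : ℝ → ℝ} (hg : Continuous g) (hw : Continuous w) (α : ℝ) :
    Continuous (radialRHS k g α w) := by
  have := continuous_radialAvg k (hg.comp hw)
  exact continuous_const.add (intervalIntegral.continuous_primitive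
    (fun a b => Continuous.intervalIntegrable (by fun_prop) a b) 0)

lemma abs_radialRHS_le (k : ℕ) {L : NNReal} {g w : ℝ → ℝ} (hg : LipschitzWith L g)
    (hw : Continuous w) {α c : ℝ}
    (hc : ∀ s, |w s| ≤ c * Real.cosh ((L + 1) * s)) (s : ℝ) :
    |radialRHS k g α w s| ≤ (|α| + (|g 0| + L * c)) * Real.cosh ((L + 1) * s) := by
  have hL : (0 : ℝ) ≤ L := L.2
  have hc0 : 0 ≤ c := by simpa using (abs_nonneg _).trans (hc 0)
  have h1 : ∀ σ, |1 / 2 * radialAvg k (g ∘ w) σ|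
      ≤ (1 / 2 * (|g 0| + L * c)) * Real.cosh ((L + 1) * σ) := by
    intro σ
    have := abs_radialAvg_sub_le k (hg.continuous.comp hw) (continuous_const (y := (0 : ℝ)))
      (s := σ) (B := (|g 0| + L * c) * Real.cosh ((L + 1) * σ)) fun ρ hρ => ?_
    · rw [abs_mul, abs_of_pos (by norm_num : (0 : ℝ) < 1 / 2), mul_assoc]
      have h0 : radialAvg k (fun _ => 0) σ = 0 := by simp [radialAvg]
      rw [h0, sub_zero] at this
      linarith
    · have h2 := hg.dist_le_mul (w (σ * ρ ^ 2)) 0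
      have h3 := hc (σ * ρ ^ 2)
      have h4 := cosh_mul_mul_sq_le (L + 1) σ hρ
      have h5 := Real.one_le_cosh ((L + 1) * σ)
      simp only [Real.dist_eq, sub_zero] at h2 ⊢
      have h6 : |g (w (σ * ρ ^ 2))| ≤ |g 0| + L * |w (σ * ρ ^ 2)| := by
        have := abs_add_le (g (w (σ * ρ ^ 2)) - g 0) (g 0)
        rw [sub_add_cancel] at this
        linarith
      have h7 : |w (σ * ρ ^ 2)| ≤ c * Real.cosh ((L + 1) * σ) :=
        h3.trans (mul_le_mul_of_nonneg_left h4 hc0)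
      have h8 := mul_le_mul_of_nonneg_left h7 hL
      simp only [Function.comp]
      nlinarith [abs_nonneg (g 0)]
  have h2 := abs_integral_le_mul_cosh (by positivity : (0 : ℝ) < L + 1) (by positivity) h1 s
  have h3 := Real.one_le_cosh ((L + 1) * s)
  have h4 : 1 / 2 * (|g 0| + L * c) / (L + 1) ≤ |g 0| + L * c := by
    rw [div_le_iff₀ (by positivity)]
    have : 0 ≤ |g 0| + L * c := by positivity
    nlinarith
  have h5 := mul_le_mul_of_nonneg_right h4 (zero_le_one.trans h3)
  refine (abs_add_le _ _).trans ?_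
  nlinarith [abs_nonneg α]

lemma abs_radialRHS_sub_le (k : ℕ) {L : NNReal} {g w₁ w₂ : ℝ → ℝ} (hg : LipschitzWith L g)
    (hw₁ : Continuous w₁) (hw₂ : Continuous w₂) {α β c : ℝ}
    (hc : ∀ s, |w₁ s - w₂ s| ≤ c * Real.cosh ((L + 1) * s)) (s : ℝ) :
    |radialRHS k g α w₁ s - radialRHS k g β w₂ s|
      ≤ (|α - β| + c / 2) * Real.cosh ((L + 1) * s) := by
  have hL : (0 : ℝ) ≤ L := L.2
  have hc0 : 0 ≤ c := by simpa using (abs_nonneg _).trans (hc 0)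
  have hi₁ := continuous_radialAvg k (hg.continuous.comp hw₁)
  have hi₂ := continuous_radialAvg k (hg.continuous.comp hw₂)
  have h1 : ∀ σ, |1 / 2 * radialAvg k (g ∘ w₁) σ - 1 / 2 * radialAvg k (g ∘ w₂) σ|
      ≤ (1 / 2 * (L * c)) * Real.cosh ((L + 1) * σ) := by
    intro σ
    have := abs_radialAvg_sub_le k (hg.continuous.comp hw₁) (hg.continuous.comp hw₂)
      (s := σ) (B := (L * c) * Real.cosh ((L + 1) * σ)) fun ρ hρ => ?_
    · rw [← mul_sub, abs_mul, abs_of_pos (by norm_num : (0 : ℝ) < 1 / 2), mul_assoc]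
      linarith
    · have h2 := hg.dist_le_mul (w₁ (σ * ρ ^ 2)) (w₂ (σ * ρ ^ 2))
      have h3 := hc (σ * ρ ^ 2)
      have h4 := cosh_mul_mul_sq_le (L + 1) σ hρ
      simp only [Real.dist_eq] at h2
      have h8 := mul_le_mul_of_nonneg_left
        (h3.trans (mul_le_mul_of_nonneg_left h4 hc0)) hL
      simp only [Function.comp]
      linarith
  have h2 := abs_integral_le_mul_cosh (by positivity : (0 : ℝ) < L + 1) (by positivity) h1 s
  have h3 := Real.one_le_cosh ((L + 1) * s)
  have h4 : 1 / 2 * (L * c) / (L + 1) ≤ c / 2 := by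
    rw [div_le_iff₀ (by positivity)]
    nlinarith
  have h5 := mul_le_mul_of_nonneg_right h4 (zero_le_one.trans h3)
  rw [intervalIntegral.integral_sub (Continuous.intervalIntegrable (by fun_prop) _ _)
    (Continuous.intervalIntegrable (by fun_prop) _ _)] at h2
  have h6 : radialRHS k g α w₁ s - radialRHS k g β w₂ s = (α - β) +
      ((∫ σ in (0 : ℝ)..s, 1 / 2 * radialAvg k (g ∘ w₁) σ)
        - ∫ σ in (0 : ℝ)..s, 1 / 2 * radialAvg k (g ∘ w₂) σ) := by
    simp only [radialRHS]
    ring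
  rw [h6]
  refine (abs_add_le _ _).trans ?_
  nlinarith [abs_nonneg (α - β)]

/-- The solutions of the radial integral equation, with Lipschitz dependence on the initial
value in a weighted norm. -/
theorem exists_radialRHS_fixedPoint (k : ℕ) {L : NNReal} {g : ℝ → ℝ} (hg : LipschitzWith L g) :
    ∃ w : ℝ → ℝ → ℝ, (∀ α, Continuous (w α)) ∧ (∀ α s, w α s = radialRHS k g α (w α) s) ∧
      (∀ α β s, |w α s - w β s| ≤ 2 * |α - β| * Real.cosh ((L + 1) * s)) ∧
      ∀ α, g α = 0 → ∀ s, w α s = α := by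
  have hpos : ∀ s, 0 < Real.cosh ((L + 1) * s) := fun s => Real.cosh_pos _
  let u : BoundedContinuousFunction ℝ ℝ → ℝ → ℝ := fun h s => h s * Real.cosh ((L + 1) * s)
  have hu : ∀ h, Continuous (u h) := fun h => h.continuous.mul (by fun_prop)
  have hub : ∀ h s, |u h s| ≤ ‖h‖ * Real.cosh ((L + 1) * s) := fun h s => by
    rw [abs_mul, abs_of_pos (hpos s)]
    exact mul_le_mul_of_nonneg_right (h.norm_coe_le_norm s) (hpos s).le
  have hud : ∀ h₁ h₂ s, |u h₁ s - u h₂ s| ≤ dist h₁ h₂ * Real.cosh ((L + 1) * s) :=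
    fun h₁ h₂ s => by
      rw [← sub_mul, abs_mul, abs_of_pos (hpos s)]
      exact mul_le_mul_of_nonneg_right (h₁.dist_coe_le_dist s) (hpos s).le
  let T : ℝ → BoundedContinuousFunction ℝ ℝ → BoundedContinuousFunction ℝ ℝ := fun α h =>
    BoundedContinuousFunction.ofNormedAddCommGroup
      (fun s => radialRHS k g α (u h) s / Real.cosh ((L + 1) * s))
      ((continuous_radialRHS k hg.continuous (hu h) α).div (by fun_prop) fun s => (hpos s).ne')
      (|α| + (|g 0| + L * ‖h‖)) fun s => by
        rw [norm_div, Real.norm_of_nonneg (hpos s).le, div_le_iff₀ (hpos s)]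
        exact abs_radialRHS_le k hg (hu h) (hub h) s
  have hT : ∀ α β h₁ h₂, dist (T α h₁) (T β h₂) ≤ |α - β| + dist h₁ h₂ / 2 := by
    intro α β h₁ h₂
    rw [BoundedContinuousFunction.dist_le (by positivity)]
    intro s
    simp only [T, BoundedContinuousFunction.coe_ofNormedAddCommGroup]
    rw [Real.dist_eq, ← sub_div, abs_div, abs_of_pos (hpos s), div_le_iff₀ (hpos s)]
    exact abs_radialRHS_sub_le k hg (hu h₁) (hu h₂) (hud h₁ h₂) s
  have hcon : ∀ α, ContractingWith (1 / 2) (T α) := fun α =>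
    ⟨by rw [← NNReal.coe_lt_coe]; norm_num, LipschitzWith.of_dist_le_mul fun h₁ h₂ => by
      have := hT α α h₁ h₂
      rw [sub_self, abs_zero] at this
      push_cast
      linarith⟩
  let H : ℝ → BoundedContinuousFunction ℝ ℝ := fun α => ContractingWith.fixedPoint (T α) (hcon α)
  have hH : ∀ α, T α (H α) = H α := fun α => (hcon α).fixedPoint_isFixedPt
  refine ⟨fun α => u (H α), fun α => hu _, fun α s => ?_, fun α β s => ?_,
    fun α hα s => ?_⟩
  · have h1 : T α (H α) s = H α s := by rw [hH]
    simp only [T, BoundedContinuousFunction.coe_ofNormedAddCommGroup] at h1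
    rw [div_eq_iff (hpos s).ne'] at h1
    exact h1.symm
  · refine (hud _ _ s).trans (mul_le_mul_of_nonneg_right ?_ (hpos s).le)
    have := hT α β (H α) (H β)
    rw [hH, hH] at this
    linarith
  · let c : BoundedContinuousFunction ℝ ℝ := BoundedContinuousFunction.ofNormedAddCommGroup
      (fun s => α / Real.cosh ((L + 1) * s))
      (continuous_const.div (by fun_prop) fun s => (hpos s).ne') |α| fun s => by
        rw [norm_div, Real.norm_of_nonneg (hpos s).le, div_le_iff₀ (hpos s), Real.norm_eq_abs]
        exact le_mul_of_one_le_right (abs_nonneg _) (Real.one_le_cosh _)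
    have huc : u c = fun _ => α := by
      funext s
      simp only [u, c, BoundedContinuousFunction.coe_ofNormedAddCommGroup]
      exact div_mul_cancel₀ _ (hpos s).ne'
    have hc : T α c = c := by
      ext s
      simp only [T, BoundedContinuousFunction.coe_ofNormedAddCommGroup, huc]
      simp [radialRHS, radialAvg, hα, c]
    have : c = H α := (hcon α).fixedPoint_unique hc
    change u (H α) s = α
    rw [← this, huc]

/-- A family `w α` of solutions of `4 s w'' + 2 d w' = g (w)` with `w α 0 = α`, together with
the first two derivatives `p` and `q`. In the variable `s = |x|²` this is the radial form of
`Δv = g(v)` on `ℝ^d`. -/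
structure IsRadialFlow (d : ℕ) (g : ℝ → ℝ) (w p q : ℝ → ℝ → ℝ) : Prop where
  map_zero : ∀ α, w α 0 = α
  map_const : ∀ α, g α = 0 → ∀ s, w α s = α
  smooth : ∀ α (n : ℕ), ContDiff ℝ n (w α)
  hasDerivAt_w : ∀ α s, HasDerivAt (w α) (p α s) s
  hasDerivAt_p : ∀ α s, HasDerivAt (p α) (q α s) s
  ode : ∀ α s, 4 * s * q α s + 2 * d * p α s = g (w α s)
  p_le : ∀ α s B, 0 ≤ s → (∀ σ ∈ Set.Icc 0 s, g (w α σ) ≤ B) → p α s ≤ B / (2 * d)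
  dependence : ∀ R α ε : ℝ, 0 ≤ R → 0 < ε → ∃ δ > 0, ∀ β, |β - α| < δ → ∀ s ∈ Set.Icc 0 R,
    |w β s - w α s| < ε ∧ |p β s - p α s| < ε

theorem exists_isRadialFlow (k : ℕ) {L : NNReal} {g : ℝ → ℝ} (hg : LipschitzWith L g)
    (hs : ∀ n : ℕ, ContDiff ℝ n g) : ∃ w p q, IsRadialFlow (k + 1) g w p q := by
  obtain ⟨w, hwc, hwe, hwd, hwk⟩ := exists_radialRHS_fixedPoint k hg
  have hgc := hg.continuous
  have hp : ∀ α s, HasDerivAt (w α) (1 / 2 * radialAvg k (g ∘ w α) s) s := fun α s => by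
    have h1 := continuous_radialAvg k (hgc.comp (hwc α))
    have h2 : Continuous fun σ => 1 / 2 * radialAvg k (g ∘ w α) σ := by fun_prop
    have h3 := ((h2.integral_hasStrictDerivAt 0 s).hasDerivAt).const_add α
    exact h3.congr_of_eventuallyEq (Eventually.of_forall fun s => hwe α s)
  have hsm : ∀ α (n : ℕ), ContDiff ℝ n (w α) := fun α n => by
    induction n with
    | zero => exact contDiff_zero.2 (hwc α)
    | succ n ih =>
      rw [Nat.cast_succ, contDiff_succ_iff_deriv]
      refine ⟨fun s => (hp α s).differentiableAt, by simp, ?_⟩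
      rw [funext fun s => (hp α s).deriv]
      exact contDiff_const.mul (contDiff_radialAvg n k ((hs n).comp ih))
  have hgw : ∀ α, ContDiff ℝ 1 (g ∘ w α) := fun α => by
    simpa using (hs 1).comp (hsm α 1)
  refine ⟨w, fun α s => 1 / 2 * radialAvg k (g ∘ w α) s,
    fun α s => 1 / 2 * radialAvg (k + 2) (deriv (g ∘ w α)) s, fun α => ?_, hwk, hsm, hp,
    fun α s => (hasDerivAt_radialAvg k (hgw α) s).const_mul _, fun α s => ?_,
    fun α s B h0 hB => ?_, fun R α ε hR hε => ?_⟩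
  · rw [hwe, radialRHS]
    simp
  · have := radialAvg_integration_by_parts k (hgw α) s
    push_cast
    simp only [Function.comp_def] at this ⊢
    linarith
  · have := radialAvg_le k (hgc.comp (hwc α)) (s := s) (B := B) fun ρ hρ => hB _
      ⟨mul_nonneg h0 (sq_nonneg ρ), mul_le_of_le_one_right h0 (pow_le_one₀ hρ.1 hρ.2)⟩
    push_cast
    calc 1 / 2 * radialAvg k (g ∘ w α) s ≤ 1 / 2 * (B / (k + 1)) := by linarith
      _ = _ := by field_simp
  · set C := Real.cosh ((L + 1) * R) with hC
    have hCpos : 0 < C := Real.cosh_pos _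
    have hL : (0 : ℝ) ≤ L := L.2
    have hcosh : ∀ s ∈ Set.Icc 0 R, Real.cosh ((L + 1) * s) ≤ C := fun s h => by
      rw [hC, Real.cosh_le_cosh, abs_mul, abs_mul, abs_of_nonneg h.1, abs_of_nonneg hR]
      exact mul_le_mul_of_nonneg_left h.2 (abs_nonneg _)
    refine ⟨ε / (2 * C * (L + 1)), by positivity, fun β hβ s hs => ?_⟩
    rw [lt_div_iff₀ (by positivity)] at hβ
    have hbd : ∀ s ∈ Set.Icc 0 R, |w β s - w α s| ≤ 2 * |β - α| * C := fun s h =>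
      (hwd β α s).trans (mul_le_mul_of_nonneg_left (hcosh s h) (by positivity))
    have hn : 0 ≤ |β - α| * C := by positivity
    refine ⟨(hbd s hs).trans_lt (by nlinarith), ?_⟩
    have := abs_radialAvg_sub_le k (hgc.comp (hwc β)) (hgc.comp (hwc α)) (s := s)
      (B := L * (2 * |β - α| * C)) fun ρ hρ => ?_
    · rw [← mul_sub, abs_mul, abs_of_pos (by norm_num : (0 : ℝ) < 1 / 2)]
      nlinarith
    · have h2 := hg.dist_le_mul (w β (s * ρ ^ 2)) (w α (s * ρ ^ 2))
      simp only [Real.dist_eq] at h2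
      exact h2.trans (mul_le_mul_of_nonneg_left (hbd _ ⟨mul_nonneg hs.1 (sq_nonneg ρ),
        (mul_le_of_le_one_right hs.1 (pow_le_one₀ hρ.1 hρ.2)).trans hs.2⟩) hL)

/-- `g` is a smooth globally Lipschitz function which coincides with the cubic-quintic
nonlinearity `x - 3x³ + x⁵` on `[-2, 2]`, and `G` is its antiderivative. -/
structure IsTruncatedCubicQuintic (L : NNReal) (g G : ℝ → ℝ) : Prop where
  lipschitz : LipschitzWith L g
  smooth : ∀ n : ℕ, ContDiff ℝ n g
  eq_of_abs_le : ∀ x, |x| ≤ 2 → g x = x - 3 * x ^ 3 + x ^ 5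
  hasDerivAt : ∀ x, HasDerivAt G (g x) x
  antideriv_eq_of_abs_le : ∀ x, |x| ≤ 2 → G x = x ^ 2 / 2 - 3 * x ^ 4 / 4 + x ^ 6 / 6

theorem exists_isTruncatedCubicQuintic : ∃ L g G, IsTruncatedCubicQuintic L g G := by
  let χ : ContDiffBump (0 : ℝ) := ⟨2, 3, by norm_num, by norm_num⟩
  let g : ℝ → ℝ := fun x => χ x * (x - 3 * x ^ 3 + x ^ 5)
  have hs : ∀ n : ℕ, ContDiff ℝ n g := fun n => χ.contDiff.mul (by fun_prop)
  have hsupp : HasCompactSupport g := χ.hasCompactSupport.mul_right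
  obtain ⟨L, hL⟩ := ContDiff.lipschitzWith_of_hasCompactSupport hsupp (hs 1) (by simp)
  have hg : ∀ x, |x| ≤ 2 → g x = x - 3 * x ^ 3 + x ^ 5 := fun x hx => by
    have : χ x = 1 := χ.one_of_mem_closedBall (by simpa using hx)
    simp [g, this]
  refine ⟨L, g, fun x => ∫ y in (0 : ℝ)..x, g y, hL, hs, hg,
    fun x => (hL.continuous.integral_hasStrictDerivAt 0 x).hasDerivAt, fun x hx => ?_⟩
  rw [intervalIntegral.integral_congr (g := fun y => y - 3 * y ^ 3 + y ^ 5) fun y hy => hg y ?_]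
  · rw [intervalIntegral.integral_eq_sub_of_hasDerivAt
      (f := fun y => y ^ 2 / 2 - 3 * y ^ 4 / 4 + y ^ 6 / 6) (fun y _ => ?_)
      (Continuous.intervalIntegrable (by fun_prop) _ _)]
    · simp
    · refine ((((hasDerivAt_pow 2 y).div_const 2).sub
        (((hasDerivAt_pow 4 y).const_mul 3).div_const 4)).add
        ((hasDerivAt_pow 6 y).div_const 6)).congr_deriv ?_
      norm_num
      ring
  · have := Set.abs_sub_left_of_mem_uIcc hy
    simp only [sub_zero] at this
    exact this.trans hx

lemma IsTruncatedCubicQuintic.map_zero {L : NNReal} {g G : ℝ → ℝ}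
    (hg : IsTruncatedCubicQuintic L g G) : g 0 = 0 := by
  rw [hg.eq_of_abs_le 0 (by simp)]; norm_num

lemma IsTruncatedCubicQuintic.antideriv_zero {L : NNReal} {g G : ℝ → ℝ}
    (hg : IsTruncatedCubicQuintic L g G) : G 0 = 0 := by
  rw [hg.antideriv_eq_of_abs_le 0 (by simp)]; norm_num

lemma three_halves_lt_goldenRatio : 3 / 2 < Real.goldenRatio := by
  nlinarith [Real.goldenRatio_sq, Real.goldenRatio_pos]

lemma IsTruncatedCubicQuintic.map_goldenRatio {L : NNReal} {g G : ℝ → ℝ}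
    (hg : IsTruncatedCubicQuintic L g G) : g Real.goldenRatio = 0 := by
  have h1 := Real.goldenRatio_sq
  have h2 : Real.goldenRatio ^ 4 = 3 * Real.goldenRatio ^ 2 - 1 := by
    linear_combination (Real.goldenRatio ^ 2 + Real.goldenRatio - 1) * h1
  rw [hg.eq_of_abs_le _ (by rw [abs_of_pos Real.goldenRatio_pos]; exact Real.goldenRatio_lt_two.le)]
  linear_combination Real.goldenRatio * h2

lemma IsTruncatedCubicQuintic.half_le_sq_of_antideriv_nonpos {L : NNReal} {g G : ℝ → ℝ}
    (hg : IsTruncatedCubicQuintic L g G) {x : ℝ} (h0 : 0 < x) (h2 : x ≤ 2) (hG : G x ≤ 0) :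
    1 / 2 ≤ x ^ 2 := by
  rw [hg.antideriv_eq_of_abs_le _ (by rwa [abs_of_pos h0])] at hG
  have h1 : 0 < x ^ 2 := by positivity
  have h3 : x ^ 2 * (1 / 2 - 3 * x ^ 2 / 4 + (x ^ 2) ^ 2 / 6) ≤ 0 := by linarith
  have h4 : 1 / 2 - 3 * x ^ 2 / 4 + (x ^ 2) ^ 2 / 6 ≤ 0 := nonpos_of_mul_nonpos_right h3 h1
  nlinarith

lemma IsTruncatedCubicQuintic.antideriv_ge_of_sq_lt_half {L : NNReal} {g G : ℝ → ℝ}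
    (hg : IsTruncatedCubicQuintic L g G) {x : ℝ} (h0 : 0 < x) (h2 : x ^ 2 < 1 / 2) :
    x ^ 2 / 8 ≤ G x := by
  rw [hg.antideriv_eq_of_abs_le _ (by rw [abs_of_pos h0]; nlinarith)]
  have h1 : 0 < x ^ 2 := by positivity
  have h3 : 0 ≤ 1 / 2 - 1 / 8 - 3 * x ^ 2 / 4 + (x ^ 2) ^ 2 / 6 := by nlinarith
  nlinarith [mul_nonneg h1.le h3]

lemma IsTruncatedCubicQuintic.neg_of_half_le_sq {L : NNReal} {g G : ℝ → ℝ}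
    (hg : IsTruncatedCubicQuintic L g G) {x : ℝ} (h0 : 0 < x) (h2 : x < Real.goldenRatio)
    (h3 : 1 / 2 ≤ x ^ 2) : g x < 0 := by
  have h4 := Real.goldenRatio_sq
  have h5 := three_halves_lt_goldenRatio
  rw [hg.eq_of_abs_le _ (by rw [abs_of_pos h0]; linarith [Real.goldenRatio_lt_two])]
  have h6 : (x ^ 2 - (Real.goldenRatio + 1)) * (x ^ 2 - (2 - Real.goldenRatio)) < 0 :=
    mul_neg_of_neg_of_pos (by nlinarith) (by linarith)
  have h7 : x - 3 * x ^ 3 + x ^ 5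
      = x * ((x ^ 2 - (Real.goldenRatio + 1)) * (x ^ 2 - (2 - Real.goldenRatio))) := by
    linear_combination x * h4
  rw [h7]
  exact mul_neg_of_pos_of_neg h0 h6

lemma IsTruncatedCubicQuintic.antideriv_le_of_ge {L : NNReal} {g G : ℝ → ℝ}
    (hg : IsTruncatedCubicQuintic L g G) {x : ℝ} (h0 : 3 / 2 ≤ x) (h2 : x ≤ Real.goldenRatio) :
    G x ≤ -7 / 10 := by
  have h4 := Real.goldenRatio_sq
  have h5 : Real.goldenRatio < 33 / 20 := by
    nlinarith [Real.goldenRatio_pos]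
  have h6 : 9 / 4 ≤ x ^ 2 := by nlinarith
  have h7 : x ^ 2 ≤ 11 / 4 := by nlinarith
  rw [hg.antideriv_eq_of_abs_le _ (by rw [abs_of_pos (by linarith)]; linarith)]
  have h8 : x ^ 2 / 2 - 3 * x ^ 4 / 4 + x ^ 6 / 6
      = x ^ 2 * (1 / 2 - 3 * x ^ 2 / 4 + (x ^ 2) ^ 2 / 6) := by ring
  have h9 : 1 / 2 - 3 * x ^ 2 / 4 + (x ^ 2) ^ 2 / 6 ≤ -(7 / 10) * (4 / 9) := by
    nlinarith
  rw [h8]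
  nlinarith

lemma IsTruncatedCubicQuintic.antideriv_le_one {L : NNReal} {g G : ℝ → ℝ}
    (hg : IsTruncatedCubicQuintic L g G) {x : ℝ} (h0 : 0 ≤ x) (h2 : x ≤ Real.goldenRatio) :
    |G x| ≤ 1 := by
  have h4 := Real.goldenRatio_sq
  have h5 : Real.goldenRatio < 33 / 20 := by
    nlinarith [Real.goldenRatio_pos]
  have h6 : 0 ≤ x ^ 2 := by positivity
  have h7 : x ^ 2 ≤ 11 / 4 := by nlinarith
  rw [hg.antideriv_eq_of_abs_le _ (by rw [abs_of_nonneg h0]; linarith)]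
  have h8 : x ^ 2 / 2 - 3 * x ^ 4 / 4 + x ^ 6 / 6
      = x ^ 2 * (1 / 2 - 3 * x ^ 2 / 4 + (x ^ 2) ^ 2 / 6) := by ring
  rw [h8, abs_le]
  constructor <;>
    nlinarith [mul_nonneg h6 (sub_nonneg.2 h7), sq_nonneg (x ^ 2 - 11 / 4),
      mul_nonneg (mul_nonneg h6 (sub_nonneg.2 h7)) h6, mul_nonneg h6 (sq_nonneg (x ^ 2 - 9 / 4)),
      mul_nonneg h6 (sq_nonneg (x ^ 2 - 5 / 2))]

namespace IsRadialFlow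

lemma continuous_w {d : ℕ} {g : ℝ → ℝ} {w p q : ℝ → ℝ → ℝ} (hw : IsRadialFlow d g w p q) (α : ℝ) :
    Continuous (w α) :=
  (hw.smooth α 0).continuous

lemma continuous_p {d : ℕ} {g : ℝ → ℝ} {w p q : ℝ → ℝ → ℝ} (hw : IsRadialFlow d g w p q) (α : ℝ) :
    Continuous (p α) :=
  continuous_iff_continuousAt.2 fun s => (hw.hasDerivAt_p α s).continuousAt

lemma hasDerivAt_energy {d : ℕ} {L : NNReal} {g G : ℝ → ℝ} {w p q : ℝ → ℝ → ℝ}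
    (hg : IsTruncatedCubicQuintic L g G) (hw : IsRadialFlow d g w p q) (α s : ℝ) :
    HasDerivAt (fun s => 2 * s * p α s ^ 2 - G (w α s)) (-(2 * d - 2) * p α s ^ 2) s := by
  have h1 : HasDerivAt (fun s : ℝ => 2 * s) 2 s := by
    simpa using (hasDerivAt_id s).const_mul (2 : ℝ)
  refine ((h1.mul ((hw.hasDerivAt_p α s).pow 2)).sub
    ((hg.hasDerivAt (w α s)).comp s (hw.hasDerivAt_w α s))).congr_deriv ?_
  rw [← hw.ode α s]
  norm_num
  ring

lemma antitone_energy {d : ℕ} {L : NNReal} {g G : ℝ → ℝ} {w p q : ℝ → ℝ → ℝ} (hd : 1 ≤ d)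
    (hg : IsTruncatedCubicQuintic L g G) (hw : IsRadialFlow d g w p q) (α : ℝ) :
    Antitone fun s => 2 * s * p α s ^ 2 - G (w α s) := by
  have h1 : (1 : ℝ) ≤ d := by exact_mod_cast hd
  refine antitone_of_deriv_nonpos
    (fun s => (hasDerivAt_energy hg hw α s).differentiableAt) fun s => ?_
  rw [(hasDerivAt_energy hg hw α s).deriv]
  nlinarith [sq_nonneg (p α s)]

/-- Once the energy is negative, the solution cannot reach zero. -/
lemma pos_of_energy_neg {d : ℕ} {L : NNReal} {g G : ℝ → ℝ} {w p q : ℝ → ℝ → ℝ} (hd : 1 ≤ d)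
    (hg : IsTruncatedCubicQuintic L g G) (hw : IsRadialFlow d g w p q) {α s₁ : ℝ} (h₁ : 0 ≤ s₁)
    (hpos : ∀ s ∈ Set.Icc 0 s₁, 0 < w α s) (hE : 2 * s₁ * p α s₁ ^ 2 - G (w α s₁) < 0)
    {s : ℝ} (hs : 0 ≤ s) : 0 < w α s := by
  by_contra! hn
  have hlt : s₁ < s := by
    by_contra! h
    exact absurd (hpos s ⟨hs, h⟩) (not_lt.2 hn)
  obtain ⟨t, ht, h0⟩ := intermediate_value_Icc' hlt.le (hw.continuous_w α).continuousOn
    ⟨hn, (hpos s₁ ⟨h₁, le_rfl⟩).le⟩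
  have h2 := antitone_energy hd hg hw α ht.1
  simp only [h0, hg.antideriv_zero] at h2
  have : 0 ≤ t := h₁.trans ht.1
  have : 0 ≤ 2 * t * p α t ^ 2 := by positivity
  linarith

/-- As long as the solution is positive with nonnegative energy it decreases. -/
lemma deriv_neg_of_energy_nonneg {d : ℕ} {L : NNReal} {g G : ℝ → ℝ} {w p q : ℝ → ℝ → ℝ}
    (hd : 1 ≤ d) (hg : IsTruncatedCubicQuintic L g G) (hw : IsRadialFlow d g w p q) {α T : ℝ}
    (hα : α < Real.goldenRatio) (hpos : ∀ s ∈ Set.Icc 0 T, 0 < w α s)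
    (hE : ∀ s ∈ Set.Icc 0 T, 0 ≤ 2 * s * p α s ^ 2 - G (w α s)) :
    ∀ s ∈ Set.Icc 0 T, p α s < 0 := by
  by_contra! hcon
  have hd' : (0 : ℝ) < 2 * d := by
    have : (1 : ℝ) ≤ d := by exact_mod_cast hd
    linarith
  have hA : IsCompact (Set.Icc 0 T ∩ {s | 0 ≤ p α s}) :=
    isCompact_Icc.inter_right (isClosed_le continuous_const (hw.continuous_p α))
  obtain ⟨t, ⟨htT, ht0⟩, hmin⟩ := hA.exists_isLeast hcon
  have hlt : ∀ s, 0 ≤ s → s < t → p α s < 0 := fun s h0 h1 => by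
    by_contra! h2
    exact absurd (hmin ⟨⟨h0, h1.le.trans htT.2⟩, h2⟩) (not_le.2 h1)
  have hanti : AntitoneOn (w α) (Set.Icc 0 t) := by
    refine antitoneOn_of_deriv_nonpos (convex_Icc _ _) (hw.continuous_w α).continuousOn
      (fun s _ => (hw.hasDerivAt_w α s).differentiableAt.differentiableWithinAt) fun s hs => ?_
    rw [interior_Icc] at hs
    rw [(hw.hasDerivAt_w α s).deriv]
    exact (hlt s hs.1.le hs.2).le
  have hzero : t * p α t ^ 2 = 0 := by
    rcases htT.1.eq_or_lt with h | h
    · rw [← h, zero_mul]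
    · have h1 : p α t ≤ 0 := by
        refine le_of_tendsto ((hw.continuous_p α).tendsto t |>.mono_left
          (nhdsWithin_le_nhds (s := Set.Iio t))) ?_
        filter_upwards [Ioo_mem_nhdsLT h] with s hs
        exact (hlt s hs.1.le hs.2).le
      have : p α t = 0 := le_antisymm h1 ht0
      rw [this]
      ring
  have hle : ∀ s ∈ Set.Icc 0 t, w α s ≤ α := fun s hs => by
    simpa [hw.map_zero] using hanti ⟨le_rfl, htT.1⟩ hs hs.1
  have hsub : ∀ s ∈ Set.Icc 0 t, s ∈ Set.Icc 0 T := fun s hs => ⟨hs.1, hs.2.trans htT.2⟩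
  have htt : t ∈ Set.Icc 0 t := ⟨htT.1, le_rfl⟩
  have hsq : 1 / 2 ≤ w α t ^ 2 := by
    refine hg.half_le_sq_of_antideriv_nonpos (hpos t htT) ?_ ?_
    · linarith [hle t htt, Real.goldenRatio_lt_two]
    · have := hE t htT
      linarith
  have hneg : ∀ s ∈ Set.Icc 0 t, g (w α s) < 0 := fun s hs => by
    refine hg.neg_of_half_le_sq (hpos s (hsub s hs)) ((hle s hs).trans_lt hα) ?_
    have h1 := hanti hs htt hs.2
    have h2 := hpos t htT
    nlinarith
  obtain ⟨m, hm, hmax⟩ := isCompact_Icc.exists_isMaxOn ⟨t, htt⟩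
    ((hg.lipschitz.continuous.comp (hw.continuous_w α)).continuousOn (s := Set.Icc 0 t))
  have h1 := hw.p_le α t (g (w α m)) htT.1 fun s hs => hmax hs
  have h2 : g (w α m) / (2 * d) < 0 := div_neg_of_neg_of_pos (hneg m hm) hd'
  have h3 : 0 ≤ p α t := ht0
  linarith

lemma antitoneOn_of_deriv_neg {d : ℕ} {g : ℝ → ℝ} {w p q : ℝ → ℝ → ℝ}
    (hw : IsRadialFlow d g w p q) {α : ℝ} {D : Set ℝ} (hD : Convex ℝ D)
    (hp : ∀ s ∈ D, p α s < 0) : AntitoneOn (w α) D := by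
  refine antitoneOn_of_deriv_nonpos hD (hw.continuous_w α).continuousOn
    (fun s _ => (hw.hasDerivAt_w α s).differentiableAt.differentiableWithinAt) fun s hs => ?_
  rw [(hw.hasDerivAt_w α s).deriv]
  exact (hp s (interior_subset hs)).le

/-- A positive solution with nonnegative energy eventually enters the region where the
potential is positive definite. -/
lemma eventually_sq_lt_half {d : ℕ} {L : NNReal} {g G : ℝ → ℝ} {w p q : ℝ → ℝ → ℝ}
    (hd : 1 ≤ d) (hg : IsTruncatedCubicQuintic L g G) (hw : IsRadialFlow d g w p q) {α : ℝ}
    (hα : α < Real.goldenRatio) (hpos : ∀ s, 0 ≤ s → 0 < w α s)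
    (hp : ∀ s, 0 ≤ s → p α s < 0) :
    ∃ s₁ > 0, ∀ s ≥ s₁, w α s ^ 2 < 1 / 2 := by
  have hd' : (0 : ℝ) < 2 * d := by
    have : (1 : ℝ) ≤ d := by exact_mod_cast hd
    linarith
  have hanti : AntitoneOn (w α) (Set.Ici 0) := hw.antitoneOn_of_deriv_neg (convex_Ici 0) hp
  by_contra! hcon
  have hsq : ∀ s, 0 ≤ s → 1 / 2 ≤ w α s ^ 2 := fun s hs => by
    obtain ⟨t, ht, h1⟩ := hcon (s + 1) (by linarith)
    have h2 := hanti hs (Set.mem_Ici.2 (by linarith : (0 : ℝ) ≤ t)) (by linarith)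
    nlinarith [hpos t (by linarith)]
  have hle : ∀ s, 0 ≤ s → w α s ≤ α := fun s hs => by
    simpa [hw.map_zero] using hanti Set.self_mem_Ici hs hs
  let D : Set ℝ := Set.Icc 0 α ∩ {x | 1 / 2 ≤ x ^ 2}
  have hD : IsCompact D :=
    isCompact_Icc.inter_right (isClosed_le continuous_const (by fun_prop))
  have hmem : ∀ s, 0 ≤ s → w α s ∈ D := fun s hs => ⟨⟨(hpos s hs).le, hle s hs⟩, hsq s hs⟩
  obtain ⟨m, ⟨hm1, hm2⟩, hmax⟩ := hD.exists_isMaxOn ⟨_, hmem 0 le_rfl⟩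
    hg.lipschitz.continuous.continuousOn
  have hm2' : 1 / 2 ≤ m ^ 2 := hm2
  have hm0 : 0 < m := lt_of_le_of_ne hm1.1 (by rintro rfl; norm_num at hm2')
  have hgm := hg.neg_of_half_le_sq hm0 (hm1.2.trans_lt hα) hm2'
  set c := g m / (2 * d) with hc
  have hcneg : c < 0 := div_neg_of_neg_of_pos hgm hd'
  have hpc : ∀ s, 0 ≤ s → p α s ≤ c := fun s hs =>
    hw.p_le α s (g m) hs fun σ hσ => hmax (hmem σ hσ.1)
  have h1 := (convex_Ici (0 : ℝ)).image_sub_le_mul_sub_of_deriv_le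
    (hw.continuous_w α).continuousOn
    (fun s _ => (hw.hasDerivAt_w α s).differentiableAt.differentiableWithinAt) (C := c)
    (fun s hs => by
      rw [(hw.hasDerivAt_w α s).deriv]
      exact hpc s (interior_subset hs))
    0 Set.self_mem_Ici (α / -c) (Set.mem_Ici.2 (div_nonneg (hm1.1.trans hm1.2) (by linarith)))
    (div_nonneg (hm1.1.trans hm1.2) (by linarith))
  have h2 : c * (α / -c - 0) = -α := by
    have h0 := hcneg.ne
    rw [sub_zero]
    field_simp
  rw [h2, hw.map_zero] at h1
  linarith [hpos (α / -c) (div_nonneg (hm1.1.trans hm1.2) (by linarith))]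

/-- Derivative of the profile in the radial variable `r = √s`. -/
lemma hasDerivAt_comp_sq {d : ℕ} {g : ℝ → ℝ} {w p q : ℝ → ℝ → ℝ}
    (hw : IsRadialFlow d g w p q) (α r : ℝ) :
    HasDerivAt (fun r => w α (r ^ 2)) (2 * r * p α (r ^ 2)) r := by
  have h1 : HasDerivAt (fun r : ℝ => r ^ 2) (2 * r) r := by simpa using hasDerivAt_pow 2 r
  exact ((hw.hasDerivAt_w α (r ^ 2)).comp r h1).congr_deriv (by ring)

/-- A positive decreasing solution cannot have energy bounded below by a positive constant. -/
lemma not_energy_ge {d : ℕ} {L : NNReal} {g G : ℝ → ℝ} {w p q : ℝ → ℝ → ℝ}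
    (hd : 1 ≤ d) (hg : IsTruncatedCubicQuintic L g G) (hw : IsRadialFlow d g w p q) {α : ℝ}
    (hα : α < Real.goldenRatio) (hpos : ∀ s, 0 ≤ s → 0 < w α s)
    (hE : ∀ s, 0 ≤ s → 1 / 2 ≤ 2 * s * p α s ^ 2 - G (w α s)) : False := by
  have hp : ∀ s, 0 ≤ s → p α s < 0 := fun s hs =>
    hw.deriv_neg_of_energy_nonneg hd hg hα (T := s) (fun σ hσ => hpos σ hσ.1)
      (fun σ hσ => by linarith [hE σ hσ.1]) s ⟨hs, le_rfl⟩
  obtain ⟨s₁, hs₁, hsm⟩ := hw.eventually_sq_lt_half hd hg hα hpos hp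
  set R := max s₁ 1 with hR
  have hR1 : 1 ≤ R := le_max_right _ _
  have hRs : ∀ r ≥ R, s₁ ≤ r ^ 2 := fun r hr => by
    have : s₁ ≤ r := (le_max_left _ _).trans hr
    nlinarith
  have hder : ∀ r ≥ R, 2 * r * p α (r ^ 2) ≤ -1 := fun r hr => by
    have h1 := hE (r ^ 2) (by positivity)
    have h2 := hg.antideriv_ge_of_sq_lt_half (hpos (r ^ 2) (by positivity)) (hsm _ (hRs r hr))
    have h3 := hp (r ^ 2) (by positivity)
    have h4 : 0 < r := by linarith
    have h5 : 2 * r * p α (r ^ 2) < 0 := by nlinarith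
    have h6 : 1 ≤ (2 * r * p α (r ^ 2)) ^ 2 := by nlinarith [sq_nonneg (w α (r ^ 2))]
    nlinarith
  have h1 := (convex_Ici R).image_sub_le_mul_sub_of_deriv_le (f := fun r => w α (r ^ 2))
    ((hw.continuous_w α).comp (by fun_prop)).continuousOn
    (fun s _ => (hw.hasDerivAt_comp_sq α s).differentiableAt.differentiableWithinAt) (C := -1)
    (fun s hs => by
      rw [(hw.hasDerivAt_comp_sq α s).deriv]
      exact hder s (interior_subset hs))
    R Set.self_mem_Ici (R + w α (R ^ 2))
    (Set.mem_Ici.2 (by linarith [hpos (R ^ 2) (by positivity)]))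
    (by linarith [hpos (R ^ 2) (by positivity)])
  have h2 := hpos ((R + w α (R ^ 2)) ^ 2) (by positivity)
  linarith

/-- For initial values close to the upper zero of the nonlinearity the solution reaches zero. -/
lemma exists_nonpos {d : ℕ} {L : NNReal} {g G : ℝ → ℝ} {w p q : ℝ → ℝ → ℝ}
    (hd : 1 ≤ d) (hg : IsTruncatedCubicQuintic L g G) (hw : IsRadialFlow d g w p q) :
    ∃ α, 1 / 2 < α ∧ α < Real.goldenRatio ∧ ∃ s, 0 ≤ s ∧ w α s ≤ 0 := by
  have hd' : (1 : ℝ) ≤ d := by exact_mod_cast hd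
  have hφ := three_halves_lt_goldenRatio
  set S : ℝ := (20 * d) ^ 2 with hS
  have hS0 : 0 < S := by positivity
  obtain ⟨δ, hδ, hdep⟩ := hw.dependence S Real.goldenRatio (Real.goldenRatio - 3 / 2) hS0.le
    (by linarith)
  obtain ⟨α, hα1, hα2⟩ : ∃ α, max (3 / 2) (Real.goldenRatio - δ) < α ∧ α < Real.goldenRatio :=
    exists_between (max_lt hφ (by linarith))
  obtain ⟨hα3, hα4⟩ := max_lt_iff.1 hα1
  refine ⟨α, by linarith, hα2, ?_⟩
  by_contra! hpos
  have hclose : ∀ s ∈ Set.Icc 0 S, 3 / 2 ≤ w α s := fun s hs => by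
    have h1 := (hdep α (by rw [abs_lt]; constructor <;> linarith) s hs).1
    rw [hw.map_const _ hg.map_goldenRatio, abs_lt] at h1
    linarith
  refine hw.not_energy_ge hd hg hα2 hpos fun s₂ hs₂ => ?_
  by_contra! hlow
  have hEc : Continuous fun s => 2 * s * p α s ^ 2 - G (w α s) :=
    continuous_iff_continuousAt.2 fun s => (hasDerivAt_energy hg hw α s).continuousAt
  have hE0 : 7 / 10 ≤ 2 * 0 * p α 0 ^ 2 - G (w α 0) := by
    rw [hw.map_zero]
    linarith [hg.antideriv_le_of_ge hα3.le hα2.le]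
  obtain ⟨T, hT, hET⟩ :
      (1 / 2 : ℝ) ∈ (fun s => 2 * s * p α s ^ 2 - G (w α s)) '' Set.Icc 0 s₂ :=
    intermediate_value_Icc' hs₂ hEc.continuousOn ⟨hlow.le, by linarith⟩
  simp only at hET
  have hanti := antitone_energy hd hg hw α
  have hElow : ∀ s ∈ Set.Icc 0 T, 1 / 2 ≤ 2 * s * p α s ^ 2 - G (w α s) := fun s hs => by
    have := hanti hs.2
    simp only at this
    linarith
  have hp := hw.deriv_neg_of_energy_nonneg hd hg hα2 (T := T) (fun s hs => hpos s hs.1)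
    (fun s hs => by linarith [hElow s hs])
  have hwa : AntitoneOn (w α) (Set.Icc 0 T) := hw.antitoneOn_of_deriv_neg (convex_Icc _ _) hp
  have hle : ∀ s ∈ Set.Icc 0 T, w α s ≤ Real.goldenRatio := fun s hs => by
    have := hwa ⟨le_rfl, hT.1⟩ hs hs.1
    rw [hw.map_zero] at this
    linarith
  have hbig : ∀ s ∈ Set.Icc 0 T, s ≤ S → 7 / 10 ≤ 2 * s * p α s ^ 2 - G (w α s) :=
    fun s hs hsS => by
      have h1 := hg.antideriv_le_of_ge (hclose s ⟨hs.1, hsS⟩) (hle s hs)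
      have h2 : 0 ≤ 2 * s * p α s ^ 2 := mul_nonneg (by linarith [hs.1]) (sq_nonneg _)
      linarith
  rcases le_or_gt T S with hTS | hTS
  · linarith [hbig T ⟨hT.1, le_rfl⟩ hTS]
  have hpS : ∀ s ∈ Set.Icc S T, (20 * d) * p α s ^ 2 ≤ - p α s := fun s hs => by
    have hs' : s ∈ Set.Icc 0 T := ⟨hS0.le.trans hs.1, hs.2⟩
    have h1 := hanti hs'.1
    simp only [hw.map_zero] at h1
    have h2 := (abs_le.1 (hg.antideriv_le_one (hpos s hs'.1).le (hle s hs'))).2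
    have h3 := (abs_le.1 (hg.antideriv_le_one (by linarith) hα2.le)).1
    have h4 : s * p α s ^ 2 ≤ 1 := by linarith
    have h5 : S * p α s ^ 2 ≤ s * p α s ^ 2 := mul_le_mul_of_nonneg_right hs.1 (sq_nonneg _)
    have h6 : (20 * d * p α s) ^ 2 ≤ 1 := by
      rw [mul_pow, ← hS]
      linarith
    have h7 := (abs_le.1 ((sq_le_one_iff_abs_le_one _).1 h6)).1
    nlinarith [hp s hs']
  have hmono : MonotoneOn (fun s => 2 * s * p α s ^ 2 - G (w α s) - 1 / 10 * w α s)
      (Set.Icc S T) := by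
    have hder : ∀ s, HasDerivAt (fun s => 2 * s * p α s ^ 2 - G (w α s) - 1 / 10 * w α s)
        (-(2 * d - 2) * p α s ^ 2 - 1 / 10 * p α s) s := fun s =>
      (hasDerivAt_energy hg hw α s).sub ((hw.hasDerivAt_w α s).const_mul _)
    refine monotoneOn_of_deriv_nonneg (convex_Icc _ _)
      (fun s _ => (hder s).continuousAt.continuousWithinAt)
      (fun s _ => (hder s).differentiableAt.differentiableWithinAt) fun s hs => ?_
    rw [(hder s).deriv]
    have := hpS s (interior_subset hs)
    nlinarith [sq_nonneg (p α s)]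
  have h1 := hmono ⟨le_rfl, hTS.le⟩ ⟨hTS.le, le_rfl⟩ hTS.le
  have h2 := hbig S ⟨hS0.le, hTS.le⟩ le_rfl
  have h3 := hle S ⟨hS0.le, hTS.le⟩
  have h4 := hpos T hT.1
  simp only at h1
  linarith [Real.goldenRatio_lt_two]

/-- A nonnegative solution with positive initial value is positive. -/
lemma pos_of_nonneg {d : ℕ} {L : NNReal} {g G : ℝ → ℝ} {w p q : ℝ → ℝ → ℝ}
    (hg : IsTruncatedCubicQuintic L g G) (hw : IsRadialFlow d g w p q) {α : ℝ} (hα : 0 < α)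
    (hnn : ∀ s, 0 ≤ s → 0 ≤ w α s) {s : ℝ} (hs : 0 ≤ s) : 0 < w α s := by
  by_contra! hcon
  have hA : IsCompact (Set.Icc 0 s ∩ {s | w α s ≤ 0}) :=
    isCompact_Icc.inter_right (isClosed_le (hw.continuous_w α) continuous_const)
  obtain ⟨t, ⟨htT, ht0⟩, hmin⟩ := hA.exists_isLeast ⟨s, ⟨hs, le_rfl⟩, hcon⟩
  have hwt : w α t = 0 := le_antisymm ht0 (hnn t htT.1)
  have htpos : 0 < t := lt_of_le_of_ne htT.1 (by
    rintro rfl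
    rw [hw.map_zero] at hwt
    exact hα.ne' hwt)
  have hpt : p α t = 0 := by
    refine IsLocalMin.hasDerivAt_eq_zero ?_ (hw.hasDerivAt_w α t)
    filter_upwards [Ioi_mem_nhds htpos] with r hr
    rw [hwt]
    exact hnn r (le_of_lt hr)
  set C : ℝ := 1 + (L + 2 * d) / t with hC
  have hder : ∀ r, HasDerivAt (fun r => (w α r ^ 2 + p α r ^ 2) * Real.exp (C * r))
      ((2 * w α r * p α r + 2 * p α r * q α r + C * (w α r ^ 2 + p α r ^ 2))
        * Real.exp (C * r)) r := fun r => by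
    have h1 : HasDerivAt (fun r : ℝ => C * r) C r := by
      simpa using (hasDerivAt_id r).const_mul C
    refine ((((hw.hasDerivAt_w α r).pow 2).add ((hw.hasDerivAt_p α r).pow 2)).mul
      h1.exp).congr_deriv ?_
    norm_num
    ring
  have hmono : MonotoneOn (fun r => (w α r ^ 2 + p α r ^ 2) * Real.exp (C * r))
      (Set.Icc (t / 2) t) := by
    refine monotoneOn_of_deriv_nonneg (convex_Icc _ _)
      (fun r _ => (hder r).continuousAt.continuousWithinAt)
      (fun r _ => (hder r).differentiableAt.differentiableWithinAt) fun r hr => ?_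
    rw [(hder r).deriv]
    refine mul_nonneg ?_ (Real.exp_pos _).le
    have hr' := interior_subset hr
    have h1 := hg.lipschitz.dist_le_mul (w α r) 0
    rw [hg.map_zero, dist_zero_right, dist_zero_right, Real.norm_eq_abs, Real.norm_eq_abs,
      ← hw.ode α r] at h1
    have hL : (0 : ℝ) ≤ L := L.2
    have hdn : (0 : ℝ) ≤ d := d.cast_nonneg
    have h2 : 2 * t * |q α r| ≤ L * |w α r| + 2 * d * |p α r| := by
      have h3 : |4 * r * q α r| ≤ |4 * r * q α r + 2 * d * p α r| + |2 * d * p α r| := by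
        have := abs_sub (4 * r * q α r + 2 * d * p α r) (2 * d * p α r)
        rwa [add_sub_cancel_right] at this
      rw [abs_mul, abs_mul (2 * (d : ℝ)), abs_of_nonneg (by linarith [hr'.1] : 0 ≤ 4 * r),
        abs_of_nonneg (by positivity : (0 : ℝ) ≤ 2 * d)] at h3
      have h4 : 2 * t * |q α r| ≤ 4 * r * |q α r| :=
        mul_le_mul_of_nonneg_right (by linarith [hr'.1]) (abs_nonneg _)
      linarith
    have h3 : 2 * |p α r| * |q α r| ≤ (L + 2 * d) / t * (w α r ^ 2 + p α r ^ 2) := by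
      rw [div_mul_eq_mul_div, le_div_iff₀ htpos]
      have h4 := mul_le_mul_of_nonneg_left h2 (abs_nonneg (p α r))
      have h5 : |p α r| * |w α r| ≤ w α r ^ 2 + p α r ^ 2 := by
        nlinarith [sq_nonneg (|p α r| - |w α r|), sq_abs (w α r), sq_abs (p α r)]
      have h6 : |p α r| * |p α r| ≤ w α r ^ 2 + p α r ^ 2 := by
        nlinarith [sq_abs (p α r), sq_nonneg (w α r)]
      nlinarith [mul_le_mul_of_nonneg_left h5 hL, mul_le_mul_of_nonneg_left h6 hdn]
    have h4 : -(2 * |p α r| * |q α r|) ≤ 2 * p α r * q α r := by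
      have := neg_abs_le (2 * p α r * q α r)
      rwa [abs_mul, abs_mul, abs_two] at this
    have h5 : 0 ≤ (w α r + p α r) ^ 2 := sq_nonneg _
    rw [hC]
    nlinarith
  have h1 := hmono ⟨le_rfl, by linarith⟩ ⟨by linarith, le_rfl⟩ (by linarith : t / 2 ≤ t)
  simp only [hwt, hpt] at h1
  have h2 : w α (t / 2) ^ 2 + p α (t / 2) ^ 2 ≤ 0 := by
    refine nonpos_of_mul_nonpos_left ?_ (Real.exp_pos (C * (t / 2)))
    simpa using h1
  have h3 : w α (t / 2) = 0 := by nlinarith [sq_nonneg (w α (t / 2)), sq_nonneg (p α (t / 2))]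
  have h4 := hmin ⟨⟨by linarith, by linarith [htT.2]⟩, h3.le⟩
  linarith

/-- The shooting argument: some solution stays positive with nonnegative energy. -/
theorem exists_pos_energy_nonneg {d : ℕ} {L : NNReal} {g G : ℝ → ℝ} {w p q : ℝ → ℝ → ℝ}
    (hd : 1 ≤ d) (hg : IsTruncatedCubicQuintic L g G) (hw : IsRadialFlow d g w p q) :
    ∃ α, α < Real.goldenRatio ∧ ∀ s, 0 ≤ s → 0 < w α s ∧ 0 ≤ 2 * s * p α s ^ 2 - G (w α s) := by
  obtain ⟨α₁, hα₁, hα₁', hc₁⟩ := hw.exists_nonpos hd hg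
  let Z : Set ℝ := {α | α ∈ Set.Icc (1 / 2) α₁ ∧ ∃ s, 0 ≤ s ∧ w α s ≤ 0}
  have hZne : Z.Nonempty := ⟨α₁, ⟨hα₁.le, le_rfl⟩, hc₁⟩
  have hZbdd : BddBelow Z := ⟨1 / 2, fun α h => h.1.1⟩
  set a := sInf Z with ha
  have ha1 : 1 / 2 ≤ a := le_csInf hZne fun α h => h.1.1
  have ha2 : a ≤ α₁ := csInf_le hZbdd ⟨⟨hα₁.le, le_rfl⟩, hc₁⟩
  have hhalf : ∀ s, 0 ≤ s → 0 < w (1 / 2) s := fun s hs => by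
    refine hw.pos_of_energy_neg hd hg (s₁ := 0) le_rfl (fun σ hσ => ?_) ?_ hs
    · rw [le_antisymm hσ.2 hσ.1, hw.map_zero]
      norm_num
    · rw [hw.map_zero, hg.antideriv_eq_of_abs_le _ (by rw [abs_of_pos] <;> norm_num)]
      norm_num
  have hnn : ∀ s, 0 ≤ s → 0 ≤ w a s := fun s hs => by
    by_contra! hneg
    obtain ⟨δ, hδ, hdep⟩ := hw.dependence s a (-w a s) hs (by linarith)
    have hlt : 1 / 2 < a := lt_of_le_of_ne ha1 (by
      rintro h
      rw [← h] at hneg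
      linarith [hhalf s hs])
    obtain ⟨β, hβ1, hβ2⟩ : ∃ β, max (1 / 2) (a - δ) < β ∧ β < a :=
      exists_between (max_lt hlt (by linarith))
    obtain ⟨hβ3, hβ4⟩ := max_lt_iff.1 hβ1
    have h1 := (hdep β (by rw [abs_lt]; constructor <;> linarith) s ⟨hs, le_rfl⟩).1
    rw [abs_lt] at h1
    exact absurd (csInf_le hZbdd (a := β) ⟨⟨hβ3.le, by linarith⟩, s, hs, by linarith⟩)
      (not_le.2 hβ2)
  have hpos : ∀ s, 0 ≤ s → 0 < w a s := fun s hs => hw.pos_of_nonneg hg (by linarith) hnn hs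
  refine ⟨a, by linarith, fun s hs => ⟨hpos s hs, ?_⟩⟩
  by_contra! hE
  have hcont : Continuous fun x : ℝ × ℝ => 2 * s * x.2 ^ 2 - G x.1 := by
    have : Continuous G := continuous_iff_continuousAt.2 fun x => (hg.hasDerivAt x).continuousAt
    fun_prop
  obtain ⟨ε, hε, hball⟩ := Metric.isOpen_iff.1 (isOpen_lt hcont continuous_const)
    (w a s, p a s) (show 2 * s * p a s ^ 2 - G (w a s) < 0 from hE)
  obtain ⟨m, hm, hmin⟩ := isCompact_Icc.exists_isMinOn ⟨0, le_rfl, hs⟩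
    ((hw.continuous_w a).continuousOn (s := Set.Icc 0 s))
  obtain ⟨δ, hδ, hdep⟩ := hw.dependence s a (min ε (w a m)) hs (lt_min hε (hpos m hm.1))
  obtain ⟨β, hβZ, hβ⟩ := exists_lt_of_csInf_lt hZne (show sInf Z < a + δ by linarith)
  have hβa : a ≤ β := csInf_le hZbdd hβZ
  have hβδ : |β - a| < δ := by rw [abs_lt]; constructor <;> linarith
  obtain ⟨σ, hσ, hσ'⟩ := hβZ.2
  refine absurd (hw.pos_of_energy_neg hd hg hs (α := β) (fun r hr => ?_) ?_ hσ) (not_lt.2 hσ')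
  · have h1 := (lt_min_iff.1 (hdep β hβδ r hr).1).2
    rw [abs_lt] at h1
    have h2 : w a m ≤ w a r := hmin hr
    linarith
  · have h1 := hdep β hβδ s ⟨hs, le_rfl⟩
    refine @hball (w β s, p β s) ?_
    rw [Metric.mem_ball, Prod.dist_eq, max_lt_iff]
    exact ⟨(lt_min_iff.1 h1.1).1, (lt_min_iff.1 h1.2).1⟩

end IsRadialFlow

/-- Decay at `+∞` faster than every power. -/
def RapidDecay (f : ℝ → ℝ) : Prop := ∀ k : ℕ, ∃ C, ∀ s, 1 ≤ s → s ^ k * |f s| ≤ C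

lemma RapidDecay.of_eventually {f : ℝ → ℝ} (hf : ContinuousOn f (Set.Ici 1))
    (h : ∀ k : ℕ, ∃ C S, ∀ s, S ≤ s → s ^ k * |f s| ≤ C) : RapidDecay f := fun k => by
  obtain ⟨C, S, hC⟩ := h k
  have hcont : ContinuousOn (fun s => s ^ k * |f s|) (Set.Icc 1 S) :=
    (continuousOn_id.pow k).mul (hf.mono Set.Icc_subset_Ici_self).abs
  obtain ⟨D, hD⟩ := isCompact_Icc.bddAbove_image hcont
  refine ⟨max C D, fun s hs => ?_⟩
  rcases le_total S s with h1 | h1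
  · exact (hC s h1).trans (le_max_left _ _)
  · exact (hD ⟨s, ⟨hs, h1⟩, rfl⟩).trans (le_max_right _ _)

lemma RapidDecay.add {f g : ℝ → ℝ} (hf : RapidDecay f) (hg : RapidDecay g) :
    RapidDecay fun s => f s + g s := fun k => by
  obtain ⟨C, hC⟩ := hf k
  obtain ⟨D, hD⟩ := hg k
  refine ⟨C + D, fun s hs => ?_⟩
  have h1 : s ^ k * |f s + g s| ≤ s ^ k * (|f s| + |g s|) :=
    mul_le_mul_of_nonneg_left (abs_add_le _ _) (by positivity)
  linarith [hC s hs, hD s hs]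

lemma RapidDecay.const_mul {f : ℝ → ℝ} (hf : RapidDecay f) (c : ℝ) :
    RapidDecay fun s => c * f s := fun k => by
  obtain ⟨C, hC⟩ := hf k
  refine ⟨|c| * C, fun s hs => ?_⟩
  rw [abs_mul, mul_left_comm]
  exact mul_le_mul_of_nonneg_left (hC s hs) (abs_nonneg c)

lemma RapidDecay.mul {f g : ℝ → ℝ} (hf : RapidDecay f) (hg : RapidDecay g) :
    RapidDecay fun s => f s * g s := fun k => by
  obtain ⟨C, hC⟩ := hf k
  obtain ⟨D, hD⟩ := hg 0
  refine ⟨C * D, fun s hs => ?_⟩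
  have h1 := hD s hs
  rw [pow_zero, one_mul] at h1
  have h2 : 0 ≤ s ^ k * |f s| := by positivity
  rw [abs_mul, ← mul_assoc]
  exact mul_le_mul (hC s hs) h1 (abs_nonneg _) (h2.trans (hC s hs))

lemma RapidDecay.div_id {f : ℝ → ℝ} (hf : RapidDecay f) : RapidDecay fun s => f s / s :=
  fun k => by
    obtain ⟨C, hC⟩ := hf k
    refine ⟨C, fun s hs => le_trans ?_ (hC s hs)⟩
    refine mul_le_mul_of_nonneg_left ?_ (by positivity)
    rw [abs_div, abs_of_nonneg (by linarith : 0 ≤ s)]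
    exact div_le_self (abs_nonneg _) hs

/-- Functions built from `u` and `v` by sums, scalings, products and division by the variable. -/
inductive IsLaurentExpr (u v : ℝ → ℝ) : (ℝ → ℝ) → Prop
  | fst : IsLaurentExpr u v u
  | snd : IsLaurentExpr u v v
  | add {f g} : IsLaurentExpr u v f → IsLaurentExpr u v g → IsLaurentExpr u v fun s => f s + g s
  | const_mul {f} (c : ℝ) : IsLaurentExpr u v f → IsLaurentExpr u v fun s => c * f s
  | mul {f g} : IsLaurentExpr u v f → IsLaurentExpr u v g → IsLaurentExpr u v fun s => f s * g s
  | div_id {f} : IsLaurentExpr u v f → IsLaurentExpr u v fun s => f s / s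

namespace IsLaurentExpr

lemma rapidDecay {u v f : ℝ → ℝ} (hu : RapidDecay u) (hv : RapidDecay v)
    (hf : IsLaurentExpr u v f) : RapidDecay f := by
  induction hf with
  | fst => exact hu
  | snd => exact hv
  | add _ _ h1 h2 => exact h1.add h2
  | const_mul c _ h => exact h.const_mul c
  | mul _ _ h1 h2 => exact h1.mul h2
  | div_id _ h => exact h.div_id

lemma exists_hasDerivAt {u v v' f : ℝ → ℝ} (hu : ∀ s, 0 < s → HasDerivAt u (v s) s)
    (hv : ∀ s, 0 < s → HasDerivAt v (v' s) s) (hv' : IsLaurentExpr u v v')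
    (hf : IsLaurentExpr u v f) :
    ∃ f', IsLaurentExpr u v f' ∧ ∀ s, 0 < s → HasDerivAt f (f' s) s := by
  induction hf with
  | fst => exact ⟨v, snd, hu⟩
  | snd => exact ⟨v', hv', hv⟩
  | add _ _ h1 h2 =>
    obtain ⟨f', hf', hf⟩ := h1
    obtain ⟨g', hg', hg⟩ := h2
    exact ⟨_, hf'.add hg', fun s hs => (hf s hs).add (hg s hs)⟩
  | const_mul c _ h =>
    obtain ⟨f', hf', hf⟩ := h
    exact ⟨_, hf'.const_mul c, fun s hs => (hf s hs).const_mul c⟩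
  | mul h3 h4 h1 h2 =>
    obtain ⟨f', hf', hf⟩ := h1
    obtain ⟨g', hg', hg⟩ := h2
    exact ⟨_, (hf'.mul h4).add (h3.mul hg'), fun s hs => (hf s hs).mul (hg s hs)⟩
  | div_id h3 h =>
    obtain ⟨f', hf', hf⟩ := h
    refine ⟨_, hf'.div_id.add (h3.div_id.div_id.const_mul (-1)), fun s hs => ?_⟩
    refine ((hf s hs).div (hasDerivAt_id s) hs.ne').congr_deriv ?_
    simp only [id]
    field_simp
    ring

lemma exists_iteratedDeriv_eq {u v v' : ℝ → ℝ} (hu : ∀ s, 0 < s → HasDerivAt u (v s) s)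
    (hv : ∀ s, 0 < s → HasDerivAt v (v' s) s) (hv' : IsLaurentExpr u v v') (n : ℕ) :
    ∃ f, IsLaurentExpr u v f ∧ ∀ s, 0 < s → iteratedDeriv n u s = f s := by
  induction n with
  | zero => exact ⟨u, fst, fun s _ => by rw [iteratedDeriv_zero]⟩
  | succ n ih =>
    obtain ⟨f, hf, h⟩ := ih
    obtain ⟨f', hf', h'⟩ := exists_hasDerivAt hu hv hv' hf
    refine ⟨f', hf', fun s hs => ?_⟩
    rw [iteratedDeriv_succ]
    refine ((h' s hs).congr_of_eventuallyEq ?_).deriv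
    filter_upwards [Ioi_mem_nhds hs] with r hr using h r hr

end IsLaurentExpr

/-- A smooth function whose derivatives decay rapidly at `+∞` coincides on `[0, ∞)` with a
Schwartz function. -/
theorem exists_schwartzMap_eq_of_rapidDecay {u : ℝ → ℝ} (hu : ∀ n : ℕ, ContDiff ℝ n u)
    (hd : ∀ n, RapidDecay (iteratedDeriv n u)) :
    ∃ F : SchwartzMap ℝ ℝ, ∀ s, 0 ≤ s → F s = u s := by
  let χ : ℝ → ℝ := fun s => Real.smoothTransition (2 * s + 2)
  have hχ : ∀ n : ℕ, ContDiff ℝ n χ := fun n =>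
    Real.smoothTransition.contDiff.comp ((contDiff_const.mul contDiff_id).add contDiff_const)
  have hF : ∀ n : ℕ, ContDiff ℝ n fun s => χ s * u s := fun n => (hχ n).mul (hu n)
  have hχ1 : ∀ s, -(1 / 2) ≤ s → χ s = 1 := fun s hs =>
    Real.smoothTransition.one_of_one_le (by linarith)
  have hχ0 : ∀ s, s ≤ -1 → χ s = 0 := fun s hs =>
    Real.smoothTransition.zero_of_nonpos (by linarith)
  refine ⟨⟨fun s => χ s * u s, contDiff_infty.2 hF, fun k n => ?_⟩, fun s hs => ?_⟩
  · have hcont : Continuous fun s : ℝ => ‖s‖ ^ k * ‖iteratedDeriv n (fun s => χ s * u s) s‖ :=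
      (continuous_norm.pow k).mul ((hF n).continuous_iteratedDeriv n le_rfl).norm
    obtain ⟨D, hD⟩ := isCompact_Icc.bddAbove_image
      (hcont.continuousOn (s := Set.Icc (-1 : ℝ) 1))
    obtain ⟨C, hC⟩ := hd n k
    refine ⟨max 0 (max C D), fun s => ?_⟩
    rw [norm_iteratedFDeriv_eq_norm_iteratedDeriv]
    rcases lt_or_ge s (-1) with h1 | h1
    · have h2 : (fun s => χ s * u s) =ᶠ[nhds s] fun _ => 0 := by
        filter_upwards [Iio_mem_nhds h1] with r hr
        rw [hχ0 r (le_of_lt hr), zero_mul]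
      rw [h2.iteratedDeriv_eq n]
      refine le_trans (le_of_eq ?_) (le_max_left _ _)
      simp
    rcases le_or_gt s 1 with h2 | h2
    · exact (hD ⟨s, ⟨h1, h2⟩, rfl⟩).trans ((le_max_right _ _).trans (le_max_right _ _))
    · have h3 : (fun s => χ s * u s) =ᶠ[nhds s] u := by
        filter_upwards [Ioi_mem_nhds h2] with r hr
        have hr' : 1 < r := hr
        rw [hχ1 r (by linarith), one_mul]
      rw [h3.iteratedDeriv_eq n, Real.norm_eq_abs, Real.norm_eq_abs,
        abs_of_nonneg (by linarith : 0 ≤ s)]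
      exact (hC s h2.le).trans ((le_max_left _ _).trans (le_max_right _ _))
  · show χ s * u s = u s
    rw [hχ1 s (by linarith), one_mul]

namespace IsRadialFlow

lemma rapidDecay_w {d : ℕ} {L : NNReal} {g G : ℝ → ℝ} {w p q : ℝ → ℝ → ℝ}
    (hd : 1 ≤ d) (hg : IsTruncatedCubicQuintic L g G) (hw : IsRadialFlow d g w p q) {α : ℝ}
    (hα : α < Real.goldenRatio) (hpos : ∀ s, 0 ≤ s → 0 < w α s)
    (hp : ∀ s, 0 ≤ s → p α s < 0)
    (hE : ∀ s, 0 ≤ s → 0 ≤ 2 * s * p α s ^ 2 - G (w α s)) : RapidDecay (w α) := by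
  obtain ⟨s₁, hs₁, hsm⟩ := hw.eventually_sq_lt_half hd hg hα hpos hp
  set R := max s₁ 1
  have hR1 : 1 ≤ R := le_max_right _ _
  have hRs : ∀ r, R ≤ r → s₁ ≤ r ^ 2 := fun r hr => by
    nlinarith [le_max_left s₁ 1]
  have hder : ∀ r, HasDerivAt (fun r => w α (r ^ 2) * Real.exp (r / 2))
      ((2 * r * p α (r ^ 2) + w α (r ^ 2) / 2) * Real.exp (r / 2)) r := fun r =>
    ((hw.hasDerivAt_comp_sq α r).mul ((hasDerivAt_id r).div_const 2).exp).congr_deriv (by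
      simp only [id]
      ring)
  have hanti : AntitoneOn (fun r => w α (r ^ 2) * Real.exp (r / 2)) (Set.Ici R) := by
    refine antitoneOn_of_deriv_nonpos (convex_Ici _)
      (fun r _ => (hder r).continuousAt.continuousWithinAt)
      (fun r _ => (hder r).differentiableAt.differentiableWithinAt) fun r hr => ?_
    rw [(hder r).deriv]
    refine mul_nonpos_of_nonpos_of_nonneg ?_ (Real.exp_pos _).le
    have hr' : R ≤ r := interior_subset hr
    have h0 := hpos (r ^ 2) (sq_nonneg r)
    have h1 := hg.antideriv_ge_of_sq_lt_half h0 (hsm (r ^ 2) (hRs r hr'))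
    have h2 := hE (r ^ 2) (sq_nonneg r)
    have h3 := hp (r ^ 2) (sq_nonneg r)
    have h4 : (w α (r ^ 2) / 2) ^ 2 ≤ (2 * (r * -p α (r ^ 2))) ^ 2 := by
      nlinarith
    have h5 := abs_le_of_sq_le_sq h4 (by nlinarith)
    linarith [le_of_abs_le h5]
  refine RapidDecay.of_eventually (hw.continuous_w α).continuousOn fun k => ?_
  refine ⟨w α (R ^ 2) * Real.exp (R / 2) * ((2 * k).factorial * 2 ^ (2 * k)), R ^ 2,
    fun s hs => ?_⟩
  have hs0 : 0 ≤ s := (sq_nonneg R).trans hs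
  obtain ⟨r, hr, rfl⟩ : ∃ r, R ≤ r ∧ r ^ 2 = s :=
    ⟨Real.sqrt s, Real.le_sqrt_of_sq_le hs, Real.sq_sqrt hs0⟩
  have h1 : w α (r ^ 2) * Real.exp (r / 2) ≤ w α (R ^ 2) * Real.exp (R / 2) :=
    hanti (Set.mem_Ici.2 le_rfl) hr hr
  have h2 := Real.pow_div_factorial_le_exp (r / 2) (by linarith) (2 * k)
  rw [div_pow, div_div, div_le_iff₀ (by positivity), mul_comm ((2 : ℝ) ^ _)] at h2
  have h3 := hpos (r ^ 2) (sq_nonneg r)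
  rw [abs_of_pos h3, ← pow_mul]
  calc r ^ (2 * k) * w α (r ^ 2)
      ≤ Real.exp (r / 2) * ((2 * k).factorial * 2 ^ (2 * k)) * w α (r ^ 2) :=
        mul_le_mul_of_nonneg_right h2 h3.le
    _ = w α (r ^ 2) * Real.exp (r / 2) * ((2 * k).factorial * 2 ^ (2 * k)) := by ring
    _ ≤ _ := mul_le_mul_of_nonneg_right h1 (by positivity)

lemma rapidDecay_p {d : ℕ} {L : NNReal} {g G : ℝ → ℝ} {w p q : ℝ → ℝ → ℝ}
    (hg : IsTruncatedCubicQuintic L g G) (hw : IsRadialFlow d g w p q) {α : ℝ}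
    (hpos : ∀ s, 0 ≤ s → 0 < w α s) (hp : ∀ s, 0 ≤ s → p α s < 0)
    (hwd : RapidDecay (w α)) : RapidDecay (p α) := by
  obtain ⟨C₁, hC₁⟩ := hwd 1
  set S := max 1 (2 * C₁)
  have hS1 : 1 ≤ S := le_max_left _ _
  have hsmall : ∀ s, S ≤ s → w α s ≤ 1 / 2 := fun s hs => by
    have h1 := hC₁ s (hS1.trans hs)
    rw [pow_one, abs_of_pos (hpos s (by linarith))] at h1
    have h2 := (le_max_right 1 (2 * C₁)).trans hs
    by_contra! h3
    nlinarith
  have hq : ∀ s, S ≤ s → 0 ≤ q α s := fun s hs => by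
    have h0 := hpos s (by linarith)
    have h1 := hsmall s hs
    have h2 := hw.ode α s
    rw [hg.eq_of_abs_le _ (by rw [abs_of_pos h0]; linarith)] at h2
    have h3 : 0 ≤ w α s - 3 * w α s ^ 3 + w α s ^ 5 := by
      have : 0 ≤ w α s * (1 - 3 * w α s ^ 2) := mul_nonneg h0.le (by nlinarith)
      have : 0 ≤ w α s ^ 5 := by positivity
      nlinarith
    have h4 : 2 * (d : ℝ) * p α s ≤ 0 :=
      mul_nonpos_of_nonneg_of_nonpos (by positivity) (hp s (by linarith)).le
    by_contra! h5
    nlinarith [mul_neg_of_pos_of_neg (by linarith : 0 < s) h5]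
  have hmono : MonotoneOn (p α) (Set.Ici S) := by
    refine monotoneOn_of_deriv_nonneg (convex_Ici _) (hw.continuous_p α).continuousOn
      (fun s _ => (hw.hasDerivAt_p α s).differentiableAt.differentiableWithinAt) fun s hs => ?_
    rw [(hw.hasDerivAt_p α s).deriv]
    exact hq s (interior_subset hs)
  refine RapidDecay.of_eventually (hw.continuous_p α).continuousOn fun k => ?_
  obtain ⟨C, hC⟩ := hwd k
  refine ⟨2 ^ k * C, S + 1, fun s hs => ?_⟩
  obtain ⟨ξ, hξ, hξ'⟩ := exists_hasDerivAt_eq_slope (w α) (p α) (by linarith : s - 1 < s)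
    (hw.continuous_w α).continuousOn fun x _ => hw.hasDerivAt_w α x
  rw [sub_sub_cancel, div_one] at hξ'
  have h1 := hmono (show S ≤ ξ by linarith [hξ.1]) (show S ≤ s by linarith) hξ.2.le
  have h2 := hpos s (by linarith)
  have h3 := hpos (s - 1) (by linarith)
  have h4 : |p α s| ≤ w α (s - 1) := by
    rw [abs_of_neg (hp s (by linarith))]
    linarith
  have h5 := hC (s - 1) (by linarith)
  rw [abs_of_pos h3] at h5
  calc s ^ k * |p α s| ≤ (2 * (s - 1)) ^ k * w α (s - 1) :=
        mul_le_mul (pow_le_pow_left₀ (by linarith) (by linarith) k) h4 (abs_nonneg _)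
          (pow_nonneg (by linarith) k)
    _ = 2 ^ k * ((s - 1) ^ k * w α (s - 1)) := by rw [mul_pow, mul_assoc]
    _ ≤ 2 ^ k * C := mul_le_mul_of_nonneg_left h5 (by positivity)

end IsRadialFlow

/-- A positive, rapidly decaying radial profile for the cubic-quintic equation, in the variable
`s = ‖x‖ ^ 2`. -/
theorem exists_radial_profile (k : ℕ) : ∃ (w p q : ℝ → ℝ) (F : SchwartzMap ℝ ℝ),
    (∀ s, HasDerivAt w (p s) s) ∧ (∀ s, HasDerivAt p (q s) s) ∧
    ∀ s, 0 ≤ s → 0 < w s ∧ F s = w s ∧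
      4 * s * q s + 2 * (k + 1 : ℕ) * p s = w s - 3 * w s ^ 3 + w s ^ 5 := by
  obtain ⟨L, g, G, hg⟩ := exists_isTruncatedCubicQuintic
  obtain ⟨w, p, q, hw⟩ := exists_isRadialFlow k hg.lipschitz hg.smooth
  have hd : 1 ≤ k + 1 := by omega
  obtain ⟨α, hα, h⟩ := hw.exists_pos_energy_nonneg hd hg
  have hpos : ∀ s, 0 ≤ s → 0 < w α s := fun s hs => (h s hs).1
  have hE : ∀ s, 0 ≤ s → 0 ≤ 2 * s * p α s ^ 2 - G (w α s) := fun s hs => (h s hs).2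
  have hp : ∀ s, 0 ≤ s → p α s < 0 := fun s hs =>
    hw.deriv_neg_of_energy_nonneg hd hg hα (fun r hr => hpos r hr.1) (fun r hr => hE r hr.1) s
      ⟨hs, le_rfl⟩
  have hwa : AntitoneOn (w α) (Set.Ici 0) := hw.antitoneOn_of_deriv_neg (convex_Ici _) hp
  have hode : ∀ s, 0 ≤ s →
      4 * s * q α s + 2 * (k + 1 : ℕ) * p α s = w α s - 3 * w α s ^ 3 + w α s ^ 5 :=
    fun s hs => by
      have h1 := hwa (Set.mem_Ici.2 le_rfl) hs hs
      rw [hw.map_zero] at h1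
      rw [hw.ode, hg.eq_of_abs_le]
      rw [abs_of_pos (hpos s hs)]
      linarith [Real.goldenRatio_lt_two]
  have hwd := hw.rapidDecay_w hd hg hα hpos hp hE
  have hpd := hw.rapidDecay_p hg hpos hp hwd
  have hv' : IsLaurentExpr (w α) (p α) fun s => (1 / 4) * ((w α s + ((-3) *
      (w α s * (w α s * w α s)) + (w α s * (w α s * (w α s * (w α s * w α s))) +
        (-2 * (k + 1 : ℕ)) * p α s))) / s) := by
    have h1 : IsLaurentExpr (w α) (p α) (w α) := .fst
    exact (h1.add (((h1.mul (h1.mul h1)).const_mul _).add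
      ((h1.mul (h1.mul (h1.mul (h1.mul h1)))).add (.const_mul _ .snd)))).div_id.const_mul _
  obtain ⟨F, hF⟩ := exists_schwartzMap_eq_of_rapidDecay (hw.smooth α) fun n => by
    obtain ⟨f, hf, hf'⟩ := IsLaurentExpr.exists_iteratedDeriv_eq
      (fun s _ => hw.hasDerivAt_w α s) (fun s hs => (hw.hasDerivAt_p α s).congr_deriv (by
        have := hode s hs.le
        field_simp
        linear_combination this)) hv' n
    intro m
    obtain ⟨C, hC⟩ := hf.rapidDecay hwd hpd m
    exact ⟨C, fun s hs => by
      rw [hf' s (by linarith)]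
      exact hC s hs⟩
  exact ⟨w α, p α, q α, F, hw.hasDerivAt_w α, hw.hasDerivAt_p α,
    fun s hs => ⟨hpos s hs, hF s hs, hode s hs⟩⟩

lemma lap_comp {d : ℕ} {f : Ed d → ℝ} (hf : ContDiff ℝ 2 f) {φ φ₁ φ₂ : ℝ → ℝ}
    (h₁ : ∀ t, HasDerivAt φ (φ₁ t) t) (h₂ : ∀ t, HasDerivAt φ₁ (φ₂ t) t) (x : Ed d) :
    lap d (fun y => φ (f y)) x = φ₁ (f x) * lap d f x + φ₂ (f x) * gradSq d f x := by
  have hdf : ∀ y, HasFDerivAt f (fderiv ℝ f y) y := fun y =>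
    (hf.differentiable (by norm_num) y).hasFDerivAt
  have hdd : Differentiable ℝ (fderiv ℝ f) :=
    (hf.fderiv_right (m := 1) (by norm_num)).differentiable (by norm_num)
  simp only [lap, gradSq, Finset.mul_sum, ← Finset.sum_add_distrib]
  refine Finset.sum_congr rfl fun i _ => ?_
  set e : Ed d := EuclideanSpace.single i 1
  have h3 : (fun y => fderiv ℝ (fun z => φ (f z)) y e) =
      fun y => φ₁ (f y) * fderiv ℝ f y e := funext fun y => by
    have h := (h₁ (f y)).comp_hasFDerivAt y (hdf y)
    exact congrArg (fun A : Ed d →L[ℝ] ℝ => A e) h.fderiv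
  have h4 : DifferentiableAt ℝ (fun y => fderiv ℝ f y e) x :=
    (hdd x).clm_apply (differentiableAt_const e)
  have h5 : HasFDerivAt (fun y => φ₁ (f y)) (φ₂ (f x) • fderiv ℝ f x) x :=
    (h₂ (f x)).comp_hasFDerivAt x (hdf x)
  rw [h3, fderiv_fun_mul h5.differentiableAt h4, h5.fderiv]
  simp only [add_apply, smul_apply, smul_eq_mul]
  ring

lemma fderiv_norm_sq_apply_single {d : ℕ} (x : Ed d) (i : Fin d) :
    fderiv ℝ (fun y : Ed d => ‖y‖ ^ 2) x (EuclideanSpace.single i 1) = 2 * x i := by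
  rw [(hasStrictFDerivAt_norm_sq x).hasFDerivAt.fderiv]
  simp [EuclideanSpace.inner_single_right]

lemma lap_norm_sq {d : ℕ} (x : Ed d) : lap d (fun y => ‖y‖ ^ 2) x = 2 * d := by
  simp only [lap, fderiv_norm_sq_apply_single]
  have h : ∀ i : Fin d, fderiv ℝ (fun y : Ed d => 2 * y i) x (EuclideanSpace.single i 1) = 2 :=
    fun i => by
      have h1 : HasFDerivAt (fun y : Ed d => 2 * y i)
          ((2 : ℝ) • (EuclideanSpace.proj i : Ed d →L[ℝ] ℝ)) x :=
        (EuclideanSpace.proj i : Ed d →L[ℝ] ℝ).hasFDerivAt.const_mul 2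
      rw [h1.fderiv]
      simp
  simp [h, mul_comm]

lemma gradSq_norm_sq {d : ℕ} (x : Ed d) : gradSq d (fun y => ‖y‖ ^ 2) x = 4 * ‖x‖ ^ 2 := by
  simp only [gradSq, fderiv_norm_sq_apply_single]
  rw [EuclideanSpace.real_norm_sq_eq, Finset.mul_sum]
  exact Finset.sum_congr rfl fun i _ => by ring

/-- The potential of the plate equation built from a Schwartz function is a Schwartz function. -/
lemma exists_schwartzMap_potential {d : ℕ} (v : SchwartzMap (Ed d) ℝ) :
    ∃ W : SchwartzMap (Ed d) ℝ,
      ∀ x, W x = -5 * v x ^ 8 + 24 * v x ^ 6 - 33 * v x ^ 4 + 12 * v x ^ 2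
        - 20 * v x ^ 2 * gradSq d (fun y => v y) x + 18 * gradSq d (fun y => v y) x := by
  let D : Fin d → SchwartzMap (Ed d) ℝ := fun i =>
    SchwartzMap.evalCLM ℝ (Ed d) ℝ (EuclideanSpace.single i 1)
      (SchwartzMap.fderivCLM ℝ (Ed d) ℝ v)
  have hv : (fun x => v x).HasTemperateGrowth := v.hasTemperateGrowth
  have hD : ∀ i, (fun x => D i x).HasTemperateGrowth := fun i => (D i).hasTemperateGrowth
  have h1 : (fun x => -5 * v x ^ 7 + 24 * v x ^ 5 - 33 * v x ^ 3 + 12 * v x).HasTemperateGrowth :=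
    by fun_prop
  have h2 : ∀ i, (fun x => (18 - 20 * v x ^ 2) * D i x).HasTemperateGrowth := fun i => by
    have := hD i
    fun_prop
  refine ⟨SchwartzMap.smulLeftCLM ℝ
      (fun x => -5 * v x ^ 7 + 24 * v x ^ 5 - 33 * v x ^ 3 + 12 * v x) v +
    ∑ i, SchwartzMap.smulLeftCLM ℝ (fun x => (18 - 20 * v x ^ 2) * D i x) (D i), fun x => ?_⟩
  have hs : ∑ i, D i x ^ 2 = gradSq d (fun y => v y) x := rfl
  rw [add_apply, sum_apply, SchwartzMap.smulLeftCLM_apply_apply h1]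
  simp only [SchwartzMap.smulLeftCLM_apply_apply (h2 _), smul_eq_mul, mul_assoc, ← pow_two,
    ← Finset.mul_sum, hs]
  ring

/-- Ground state for the stationary vibrating plate equation. For `d ≥ 3`
there exist a positive real-valued Schwartz function `v` such that, with
`W = -5v⁸ + 24v⁶ - 33v⁴ + 12v² - 20v²|∇v|² + 18|∇v|²`, the potential `W` is also a Schwartz
function and `Δ²v - v + W·v = 0` on `ℝ^d`. -/
theorem ground_state_plate (d : ℕ) (hd : 3 ≤ d) :
    ∃ v : SchwartzMap (Ed d) ℝ,
      (∀ x, 0 < v x) ∧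
      (∃ W : SchwartzMap (Ed d) ℝ,
        (∀ x, W x = -5 * v x ^ 8 + 24 * v x ^ 6 - 33 * v x ^ 4 + 12 * v x ^ 2
          - 20 * v x ^ 2 * gradSq d (fun y => v y) x + 18 * gradSq d (fun y => v y) x) ∧
        ∀ x, lap d (lap d (fun y => v y)) x - v x + W x * v x = 0) := by
  obtain ⟨k, rfl⟩ : ∃ k, d = k + 1 := ⟨d - 1, by omega⟩
  obtain ⟨w, p, q, F, hw, hp, h⟩ := exists_radial_profile k
  let v : SchwartzMap (Ed (k + 1)) ℝ :=
    SchwartzMap.compCLM ℝ (g := fun x : Ed (k + 1) => ‖x‖ ^ 2)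
      (Function.hasTemperateGrowth_norm_sq (Ed (k + 1)))
      ⟨1, 1, fun x => by
        rw [Real.norm_of_nonneg (sq_nonneg _)]
        nlinarith [sq_nonneg (‖x‖ - 1)]⟩ F
  have hv : ∀ x, v x = w (‖x‖ ^ 2) := fun x => (h _ (sq_nonneg _)).2.1
  obtain ⟨W, hW⟩ := exists_schwartzMap_potential v
  refine ⟨v, fun x => ?_, W, hW, fun x => ?_⟩
  · rw [hv]
    exact (h _ (sq_nonneg _)).1
  have hlap : lap (k + 1) (fun y => v y) = fun y => v y - 3 * v y ^ 3 + v y ^ 5 :=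
    funext fun y => by
      rw [funext hv, lap_comp (contDiff_norm_sq ℝ) hw hp, lap_norm_sq, gradSq_norm_sq]
      linear_combination (h _ (sq_nonneg ‖y‖)).2.2
  have h₁ : ∀ t : ℝ, HasDerivAt (fun t => t - 3 * t ^ 3 + t ^ 5) (1 - 9 * t ^ 2 + 5 * t ^ 4) t :=
    fun t => (((hasDerivAt_id t).sub ((hasDerivAt_pow 3 t).const_mul 3)).add
      (hasDerivAt_pow 5 t)).congr_deriv (by norm_num; ring)
  have h₂ : ∀ t : ℝ, HasDerivAt (fun t => 1 - 9 * t ^ 2 + 5 * t ^ 4) (-18 * t + 20 * t ^ 3) t :=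
    fun t => (((hasDerivAt_const t 1).sub ((hasDerivAt_pow 2 t).const_mul 9)).add
      ((hasDerivAt_pow 4 t).const_mul 5)).congr_deriv (by norm_num; ring)
  have hlap2 := lap_comp (v.smooth 2) h₁ h₂ x
  rw [hlap, hlap2, hlap, hW]
  ring
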